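/- arXiv:2210.09528 — 2 statements merged into one kernel-verified Lean document; each statement's English description precedes it below -/
import Mathlib

section
/- Let G be a finite simple graph with nonempty edge set such that ν(G) = ν₀(G) and G contains no cycle of length 5. Then there exists an induced subgraph H of G with ν₀(H) = ν₀(G) such that H has a perfect ordered matching and sdst(J(G)) = sdst(J(H)). -/
open SimpleGraph

namespace DS

variable {V : Type*}

/-- The set of edges of a matching presented by the endpoint functions `u`, `v`. -/
def omEdges {s : ℕ} (u v : Fin s → V) : Set (Sym2 V) := {e | ∃ i, e = s(u i, v i)}

/-- `(u, v)` describes a matching of size `s` in `G`: the `2s` endpoints are pairwise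
distinct (so the edges are pairwise disjoint) and each pair `{u i, v i}` is an edge. -/
def IsMatchingPair (G : SimpleGraph V) {s : ℕ} (u v : Fin s → V) : Prop :=
  Function.Injective (Sum.elim u v) ∧ ∀ i, G.Adj (u i) (v i)

/-- `(u, v)` describes an ordered matching: a matching such that `{u 1, …, u s}` is an
independent set and `{u i, v j} ∈ E(G)` implies `i ≤ j`. -/
def IsOrderedMatching (G : SimpleGraph V) {s : ℕ} (u v : Fin s → V) : Prop :=
  IsMatchingPair G u v ∧ (∀ i j, ¬ G.Adj (u i) (u j)) ∧
    ∀ i j, G.Adj (u i) (v j) → i ≤ j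

/-- The matching number of `G`. -/
noncomputable def nu (G : SimpleGraph V) : ℕ :=
  sSup {s | ∃ u v : Fin s → V, IsMatchingPair G u v}

/-- The ordered matching number of `G`. -/
noncomputable def nu0 (G : SimpleGraph V) : ℕ :=
  sSup {s | ∃ u v : Fin s → V, IsOrderedMatching G u v}

/-- A walk is `M`-alternating if its edges are alternately in `M` and not in `M`. -/
def IsAlt {G : SimpleGraph V} (M : Set (Sym2 V)) {a b : V} (w : G.Walk a b) : Prop :=
  List.Chain' (fun e f => (e ∈ M ↔ f ∉ M)) w.edges

/-- The walk `w` is nonempty and its first and last edges belong to `M`. -/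
def FirstLastInM {G : SimpleGraph V} (M : Set (Sym2 V)) {a b : V} (w : G.Walk a b) : Prop :=
  ∃ h : w.edges ≠ [], w.edges.head h ∈ M ∧ w.edges.getLast h ∈ M

/-- `w` is an `M`-admissible path for the vertex `x` (with respect to the ordered matching
presented by `(u, v)`): an `M`-alternating path with origin `x` whose first and last
edges are in `M`, each of whose edges has an end in `A = range u` and an end in
`B = range v`. -/
def IsAdmissible {G : SimpleGraph V} {s : ℕ} (u v : Fin s → V) {a b : V}
    (w : G.Walk a b) (x : V) : Prop :=
  a = x ∧ IsAlt (omEdges u v) w ∧ FirstLastInM (omEdges u v) w ∧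
    ∀ e ∈ w.edges, ∃ i j, e = s(u i, v j)

/-- `ℓ(x)`: the length of a longest `M`-admissible path for `x`. -/
noncomputable def ellv (G : SimpleGraph V) {s : ℕ} (u v : Fin s → V) (x : V) : ℕ :=
  sSup {n | ∃ (b : V) (w : G.Walk x b), IsAdmissible u v w x ∧ w.length = n}

/-- `ℓ(M)`: the length of a longest `M`-alternating path in `G`. -/
noncomputable def ellM (G : SimpleGraph V) (M : Set (Sym2 V)) : ℕ :=
  sSup {n | ∃ (a b : V) (w : G.Walk a b), IsAlt M w ∧ w.length = n}

/-- `ℓ₀(M) = max {ℓ(x) : x ∈ B}`. -/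
noncomputable def ell0 (G : SimpleGraph V) {s : ℕ} (u v : Fin s → V) : ℕ :=
  sSup {n | ∃ i : Fin s, ellv G u v (v i) = n}

/-- `ℓ₁(M) = max {ℓ(x) + ℓ(y) + 1 : {x, y} ∈ E(G[B])}` (with the convention that this
is `0` when `B` is independent, since `sSup ∅ = 0`). -/
noncomputable def ell1 (G : SimpleGraph V) {s : ℕ} (u v : Fin s → V) : ℕ :=
  sSup {n | ∃ i j : Fin s, G.Adj (v i) (v j) ∧ ellv G u v (v i) + ellv G u v (v j) + 1 = n}

/-- `ℓ(G) = min {ℓ(M) : M a maximum ordered matching of G}`. -/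
noncomputable def ellG (G : SimpleGraph V) : ℕ :=
  sInf {n | ∃ u v : Fin (nu0 G) → V, IsOrderedMatching G u v ∧ ellM G (omEdges u v) = n}

open MvPolynomial in
/-- The `n`-th symbolic power `J(G)^{(n)} = ⋂_{{u,v} ∈ E(G)} (x_u, x_v)^n` of the cover
ideal of `G`. -/
noncomputable def symbPow (K : Type*) [Field K] (G : SimpleGraph V) (n : ℕ) :
    Ideal (MvPolynomial V K) :=
  ⨅ (p : V × V) (_ : G.Adj p.1 p.2), (Ideal.span {X p.1, X p.2}) ^ n

/-- The cover ideal `J(G) = ⋂_{{u,v} ∈ E(G)} (x_u, x_v)`. -/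
noncomputable def coverIdeal (K : Type*) [Field K] (G : SimpleGraph V) :
    Ideal (MvPolynomial V K) :=
  symbPow K G 1

/-- `depth R/I`: the length of a maximal `R/I`-regular sequence contained in the maximal
homogeneous ideal `(x_1, …, x_r)` of `R = K[x_1, …, x_r]`. -/
noncomputable def depthQ (K : Type*) [Field K] (I : Ideal (MvPolynomial V K)) : ℕ :=
  sSup {n | ∃ rs : List (MvPolynomial V K), rs.length = n ∧
    (∀ f ∈ rs, f ∈ Ideal.span (Set.range (MvPolynomial.X : V → MvPolynomial V K))) ∧
    RingTheory.Sequence.IsRegular (MvPolynomial V K ⧸ I) rs}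

/-- The stability index of the symbolic depth function of `J(G)`:
`sdst(J(G)) = min {n₀ ≥ 1 : depth R/J(G)^{(n)} = r − ν₀(G) − 1 for all n ≥ n₀}`. -/
noncomputable def sdst (K : Type*) [Field K] [Fintype V] (G : SimpleGraph V) : ℕ :=
  sInf {n0 | 1 ≤ n0 ∧ ∀ n, n0 ≤ n →
    depthQ K (symbPow K G n) = Fintype.card V - nu0 G - 1}

/-- The stability index of the depth function of `J(G)`:
the least `n₀ ≥ 1` such that `depth R/J(G)^n` is constant for `n ≥ n₀` (hence equal to
its limit value). -/
noncomputable def dst (K : Type*) [Field K] [Fintype V] (G : SimpleGraph V) : ℕ :=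
  sInf {n0 | 1 ≤ n0 ∧ ∀ m n, n0 ≤ m → n0 ≤ n →
    depthQ K (coverIdeal K G ^ m) = depthQ K (coverIdeal K G ^ n)}

end DS

namespace DS

/-! ### Koszul chains -/

section Koszul

variable {V : Type*} [LinearOrder V] {A : Type*} [CommRing A] {M : Type*} [AddCommGroup M]
  [Module A M]

/-- The sign of inserting `j` into (or deleting `j` from) the ordered set `W`. -/
def ksign (j : V) (W : Finset V) : ℤ := (-1) ^ (W.filter (· < j)).card

lemma ksign_mul_self (j : V) (W : Finset V) : ksign j W * ksign j W = 1 := by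
  rw [ksign, ← mul_pow]; simp

lemma ksign_smul_smul (j : V) (W : Finset V) (m : M) :
    ksign j W • ksign j W • m = m := by
  rw [smul_smul, ksign_mul_self, one_smul]

lemma ksign_insert_self (j : V) (W : Finset V) : ksign j (insert j W) = ksign j W := by
  simp [ksign, Finset.filter_insert]

lemma ksign_erase_self (j : V) (W : Finset V) : ksign j (W.erase j) = ksign j W := by
  unfold ksign
  congr 2
  ext x
  simp only [Finset.mem_filter, Finset.mem_erase]
  constructor
  · rintro ⟨⟨_, h⟩, h'⟩; exact ⟨h, h'⟩
  · rintro ⟨h, h'⟩; exact ⟨⟨ne_of_lt h', h⟩, h'⟩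

lemma ksign_insert_of_lt {j k : V} {W : Finset V} (hk : k ∉ W) (h : k < j) :
    ksign j (insert k W) = -ksign j W := by
  unfold ksign
  rw [Finset.filter_insert, if_pos h, Finset.card_insert_of_notMem (by simp [hk]), pow_succ]
  ring

lemma ksign_insert_of_gt {j k : V} {W : Finset V} (h : j < k) :
    ksign j (insert k W) = ksign j W := by
  unfold ksign
  rw [Finset.filter_insert, if_neg (not_lt.2 h.le)]

lemma ksign_insert_mul {j k : V} {W : Finset V} (hjk : j ≠ k) (hj : j ∉ W) (hk : k ∉ W) :
    ksign j W * ksign k (insert j W) = -(ksign k W * ksign j (insert k W)) := by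
  rcases lt_or_gt_of_ne hjk with h | h
  · rw [ksign_insert_of_lt hj h, ksign_insert_of_gt h]; ring
  · rw [ksign_insert_of_lt hk h, ksign_insert_of_gt h]; ring

/-- Contraction of a Koszul chain with the basis vector `j`. -/
def contr (j : V) : (Finset V → M) →+ (Finset V → M) :=
  AddMonoidHom.mk' (fun c W => if j ∈ W then 0 else ksign j W • c (insert j W)) fun c c' => by
    ext W
    by_cases h : j ∈ W <;> simp [h]

/-- Exterior multiplication of a Koszul chain by the basis vector `j`. -/
def wedge (j : V) : (Finset V → M) →+ (Finset V → M) :=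
  AddMonoidHom.mk' (fun c W => if j ∈ W then ksign j W • c (W.erase j) else 0) fun c c' => by
    ext W
    by_cases h : j ∈ W <;> simp [h]

lemma contr_apply (j : V) (c : Finset V → M) (W : Finset V) :
    contr j c W = if j ∈ W then 0 else ksign j W • c (insert j W) := rfl

lemma wedge_apply (j : V) (c : Finset V → M) (W : Finset V) :
    wedge j c W = if j ∈ W then ksign j W • c (W.erase j) else 0 := rfl

lemma contr_of_mem {j : V} {W : Finset V} (h : j ∈ W) (c : Finset V → M) :
    contr j c W = 0 := if_pos h

lemma contr_of_notMem {j : V} {W : Finset V} (h : j ∉ W) (c : Finset V → M) :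
    contr j c W = ksign j W • c (insert j W) := if_neg h

lemma wedge_of_mem {j : V} {W : Finset V} (h : j ∈ W) (c : Finset V → M) :
    wedge j c W = ksign j W • c (W.erase j) := if_pos h

lemma wedge_of_notMem {j : V} {W : Finset V} (h : j ∉ W) (c : Finset V → M) :
    wedge j c W = 0 := if_neg h

lemma contr_contr_self (j : V) (c : Finset V → M) : contr j (contr j c) = 0 := by
  ext W
  by_cases h : j ∈ W <;> simp [contr_apply, h]

lemma contr_contr (j k : V) (c : Finset V → M) :
    contr j (contr k c) = -contr k (contr j c) := by
  rcases eq_or_ne j k with rfl | hjk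
  · simp [contr_contr_self]
  ext W
  by_cases hj : j ∈ W
  · by_cases hk : k ∈ W <;> simp [contr_apply, hj, hk]
  by_cases hk : k ∈ W
  · simp [contr_apply, hj, hk]
  · simp only [contr_apply, Pi.neg_apply, hj, hk, if_false, Finset.mem_insert, hjk, hjk.symm, false_or,
      smul_smul, ksign_insert_mul hjk hj hk, neg_smul, Finset.insert_comm j k W]

lemma contr_wedge_self (j : V) (c : Finset V → M) :
    contr j (wedge j c) + wedge j (contr j c) = c := by
  ext W
  by_cases h : j ∈ W
  · simp [contr_apply, wedge_apply, h, ksign_erase_self, ksign_smul_smul, Finset.insert_erase h]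
  · simp [contr_apply, wedge_apply, h, ksign_insert_self, ksign_smul_smul, Finset.erase_insert h]

lemma contr_wedge {j k : V} (hjk : j ≠ k) (c : Finset V → M) :
    contr j (wedge k c) = -wedge k (contr j c) := by
  ext W
  by_cases hj : j ∈ W
  · by_cases hk : k ∈ W <;> simp [contr_apply, wedge_apply, hj, hk, hjk]
  by_cases hk : k ∈ W
  · obtain ⟨U, hU, rfl⟩ : ∃ U, k ∉ U ∧ W = insert k U :=
      ⟨W.erase k, by simp, (Finset.insert_erase hk).symm⟩
    have hjU : j ∉ U := fun h => hj (by simp [h])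
    have h1 : (insert j (insert k U)).erase k = insert j U := by
      rw [Finset.insert_comm, Finset.erase_insert (by simp [hU, hjk.symm])]
    have h2 : ksign k (insert j (insert k U)) = ksign k (insert j U) := by
      rw [Finset.insert_comm, ksign_insert_self]
    simp only [contr_apply, wedge_apply, Pi.neg_apply, hj, if_false, Finset.mem_insert, true_or, or_true,
      if_true, Finset.erase_insert hU, hjU, h1, h2, smul_smul, ksign_insert_self, ← neg_smul]
    congr 1
    have e := ksign_insert_mul hjk hjU hU
    have e1 := ksign_mul_self j U
    have e2 := ksign_mul_self j (insert k U)
    linear_combination (ksign j U * ksign j (insert k U)) * e -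
      ksign j (insert k U) * ksign k (insert j U) * e1 - ksign j U * ksign k U * e2
  · simp [contr_apply, wedge_apply, hj, hk, hjk.symm]

lemma contr_smul (j : V) (x : A) (c : Finset V → M) : contr j (x • c) = x • contr j c := by
  ext W
  by_cases h : j ∈ W <;> simp [contr_apply, h, smul_comm x]

lemma wedge_smul (j : V) (x : A) (c : Finset V → M) : wedge j (x • c) = x • wedge j c := by
  ext W
  by_cases h : j ∈ W <;> simp [wedge_apply, h, smul_comm x]

lemma contr_eq_zero_of_card {s : ℕ} {c : Finset V → M} (hc : ∀ W, W.card ≠ s + 1 → c W = 0)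
    (j : V) {W : Finset V} (hW : W.card ≠ s) : contr j c W = 0 := by
  by_cases h : j ∈ W
  · rw [contr_of_mem h]
  · rw [contr_of_notMem h, hc _ (by rw [Finset.card_insert_of_notMem h]; omega), smul_zero]

lemma wedge_eq_zero_of_card {s : ℕ} {c : Finset V → M} (hc : ∀ W, W.card ≠ s → c W = 0)
    (j : V) {W : Finset V} (hW : W.card ≠ s + 1) : wedge j c W = 0 := by
  by_cases h : j ∈ W
  · rw [wedge_of_mem h, hc _ (by have := Finset.card_erase_add_one h; omega), smul_zero]
  · rw [wedge_of_notMem h]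

variable [Fintype V]

/-- The Koszul differential with respect to the family of scalars `a`. -/
def kdiff (a : V → A) : (Finset V → M) →ₗ[A] (Finset V → M) where
  toFun c := ∑ j, a j • contr j c
  map_add' c c' := by simp [Finset.sum_add_distrib]
  map_smul' x c := by simp [contr_smul, Finset.smul_sum, smul_comm x]

variable (a : V → A)

lemma kdiff_def (c : Finset V → M) : kdiff a c = ∑ j, a j • contr j c := rfl

lemma kdiff_apply (c : Finset V → M) (W : Finset V) :
    kdiff a c W = ∑ j, a j • contr j c W := by
  simp [kdiff_def]

lemma contr_kdiff (k : V) (c : Finset V → M) : contr k (kdiff a c) = -kdiff a (contr k c) := by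
  simp only [kdiff_def, map_sum, contr_smul, ← Finset.sum_neg_distrib, ← smul_neg]
  exact Finset.sum_congr rfl fun j _ => by rw [contr_contr]

lemma kdiff_kdiff (c : Finset V → M) : kdiff a (kdiff a c) = 0 := by
  rw [kdiff_def]
  simp only [contr_kdiff, smul_neg]
  rw [Finset.sum_neg_distrib, neg_eq_zero]
  simp only [kdiff_def, Finset.smul_sum]
  rw [← Finset.sum_product']
  refine Finset.sum_involution (fun p _ => (p.2, p.1)) ?_ ?_ (by simp) (by simp)
  · rintro ⟨j, k⟩ _
    simp only
    rw [contr_contr k j, smul_neg, smul_neg, smul_comm (a j), neg_add_cancel]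
  · rintro ⟨j, k⟩ _ h h'
    obtain rfl : k = j := by simpa using congrArg Prod.fst h'
    exact h (by simp [contr_contr_self])

lemma kdiff_wedge (k : V) (c : Finset V → M) :
    kdiff a (wedge k c) = a k • c - wedge k (kdiff a c) := by
  simp only [kdiff_def, map_sum, wedge_smul]
  rw [eq_sub_iff_add_eq, ← Finset.sum_add_distrib, Finset.sum_eq_single k]
  · rw [← smul_add, contr_wedge_self]
  · intro j _ hj
    rw [← smul_add, contr_wedge hj, neg_add_cancel, smul_zero]
  · simp

lemma kdiff_apply_congr_card {s : ℕ} {c : Finset V → M} (hc : ∀ W, W.card ≠ s + 1 → c W = 0)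
    {W : Finset V} (hW : W.card ≠ s) : kdiff a c W = 0 := by
  rw [kdiff_apply]
  refine Finset.sum_eq_zero fun j _ => ?_
  by_cases h : j ∈ W
  · rw [contr_of_mem h, smul_zero]
  · rw [contr_of_notMem h, hc _ (by rw [Finset.card_insert_of_notMem h]; omega), smul_zero,
      smul_zero]

/-- Exactness at homological degree `s` of the part of the Koszul complex consisting of the
chains `c` all of whose values satisfy `P W (c W)`. -/
def KExact (P : Finset V → M → Prop) (s : ℕ) : Prop :=
  ∀ c : Finset V → M, (∀ W, P W (c W)) → (∀ W, W.card ≠ s → c W = 0) → kdiff a c = 0 →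
    ∃ e : Finset V → M, (∀ W, P W (e W)) ∧ (∀ W, W.card ≠ s + 1 → e W = 0) ∧ kdiff a e = c

end Koszul

end DS

namespace DS

/-! ### Koszul homology and regular sequences -/

section Regular

open RingTheory.Sequence Pointwise

variable {V : Type*} {A : Type*} [CommRing A]
  {M : Type*} [AddCommGroup M] [Module A M]

lemma exists_lift_quotSMulTop {f : A} {c : Finset V → M} {t : ℕ}
    (hs : ∀ W, W.card ≠ t → c W = 0)
    (h : ∀ W, (f • (⊤ : Submodule A M)).mkQ (c W) = 0) :
    ∃ g : Finset V → M, (∀ W, W.card ≠ t → g W = 0) ∧ c = f • g := by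
  have : ∀ W, ∃ m : M, c W = f • m := fun W => by
    have := h W
    rw [Submodule.mkQ_apply, Submodule.Quotient.mk_eq_zero] at this
    obtain ⟨m, -, hm⟩ := (Submodule.mem_smul_pointwise_iff_exists _ _ _).1 this
    exact ⟨m, hm.symm⟩
  choose g hg using this
  refine ⟨fun W => if W.card = t then g W else 0, fun W hW => if_neg hW, ?_⟩
  ext W
  by_cases hW : W.card = t
  · simp [hW, hg]
  · simp [hW, hs]

lemma exists_lift_mkQ (N : Submodule A M) {c : Finset V → M ⧸ N} {t : ℕ}
    (hs : ∀ W, W.card ≠ t → c W = 0) :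
    ∃ g : Finset V → M, (∀ W, W.card ≠ t → g W = 0) ∧ (fun W => N.mkQ (g W)) = c := by
  choose g hg using fun W => N.mkQ_surjective (c W)
  refine ⟨fun W => if W.card = t then g W else 0, fun W hW => if_neg hW, ?_⟩
  ext W
  by_cases hW : W.card = t
  · simp [hW, ← hg]
  · simp [hW, hs]

variable [LinearOrder V] [Fintype V] {M' : Type*} [AddCommGroup M'] [Module A M'] (a : V → A)

lemma kdiff_map (f : M →ₗ[A] M') (c : Finset V → M) :
    kdiff a (fun W => f (c W)) = fun W => f (kdiff a c W) := by
  ext W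
  simp only [kdiff_apply, map_sum, map_smul]
  refine Finset.sum_congr rfl fun j _ => ?_
  by_cases h : j ∈ W
  · rw [contr_of_mem h, contr_of_mem h, map_zero]
  · rw [contr_of_notMem h, contr_of_notMem h, map_zsmul]

/-- Multiplication by an element of the ideal generated by the scalars `a j` is null-homotopic
on the Koszul complex. -/
lemma exists_kdiff_eq_smul {f : A} (hf : f ∈ Ideal.span (Set.range a)) {s : ℕ}
    {c : Finset V → M} (hs : ∀ W, W.card ≠ s → c W = 0) (hc : kdiff a c = 0) :
    ∃ h : Finset V → M, (∀ W, W.card ≠ s + 1 → h W = 0) ∧ kdiff a h = f • c := by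
  obtain ⟨g, rfl⟩ := (Ideal.mem_span_range_iff_exists_fun).1 hf
  refine ⟨∑ j, g j • wedge j c, fun W hW => ?_, ?_⟩
  · rw [Finset.sum_apply]
    exact Finset.sum_eq_zero fun j _ => by
      rw [Pi.smul_apply, wedge_eq_zero_of_card hs j hW, smul_zero]
  · simp only [map_sum, map_smul, kdiff_wedge, hc, map_zero, sub_zero, smul_smul, Finset.sum_smul]

lemma eq_zero_of_kdiff_of_regular {f : A} (hf : IsSMulRegular M f) {c : Finset V → M}
    (h : kdiff a (f • c) = 0) : kdiff a c = 0 := by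
  rw [map_smul] at h
  ext W
  exact hf (by simpa using congrFun h W)

/-- The Koszul complex of `M` is exact at homological degree `s`. -/
abbrev KoszulExact (M : Type*) [AddCommGroup M] [Module A M] (s : ℕ) : Prop :=
  KExact (M := M) a (fun _ _ => True) s

lemma KoszulExact.quotSMulTop {f : A} (hf : IsSMulRegular M f) {s : ℕ}
    (h1 : KoszulExact a M (s + 1)) (h0 : KoszulExact a M s) :
    KoszulExact a (QuotSMulTop f M) (s + 1) := by
  intro c _ hs hc
  obtain ⟨c, hs', rfl⟩ := exists_lift_mkQ _ hs
  rw [kdiff_map] at hc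
  obtain ⟨g, hgs, hg⟩ := exists_lift_quotSMulTop
    (fun W hW => kdiff_apply_congr_card a hs' hW) (fun W => congrFun hc W)
  have hg0 : kdiff a g = 0 := eq_zero_of_kdiff_of_regular a hf (by rw [← hg, kdiff_kdiff])
  obtain ⟨h, -, hhs, hh⟩ := h0 g (fun _ => trivial) hgs hg0
  obtain ⟨e, -, hes, he⟩ := h1 (c - f • h) (fun _ => trivial)
    (fun W hW => by simp [hs' W hW, hhs W hW]) (by rw [map_sub, map_smul, hh]; exact sub_eq_zero.2 hg)
  refine ⟨fun W => (f • (⊤ : Submodule A M)).mkQ (e W), fun _ => trivial,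
    fun W hW => by simp [hes W hW], ?_⟩
  rw [kdiff_map, he]
  ext W
  rw [Pi.sub_apply, map_sub, sub_eq_self, Submodule.mkQ_apply, Submodule.Quotient.mk_eq_zero]
  exact Submodule.smul_mem_pointwise_smul _ _ _ trivial

lemma KoszulExact.of_quotSMulTop {f : A} (hfa : f ∈ Ideal.span (Set.range a))
    (hf : IsSMulRegular M f) {s : ℕ} (h : KoszulExact a (QuotSMulTop f M) (s + 1)) :
    KoszulExact a M s := by
  intro c _ hs hc
  obtain ⟨g, hgs, hg⟩ := exists_kdiff_eq_smul a hfa hs hc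
  obtain ⟨e, -, hes, he⟩ := h (fun W => (f • (⊤ : Submodule A M)).mkQ (g W)) (fun _ => trivial)
    (fun W hW => by simp [hgs W hW]) (by
      rw [kdiff_map, hg]
      ext W
      rw [Pi.smul_apply, Submodule.mkQ_apply, Pi.zero_apply, Submodule.Quotient.mk_eq_zero]
      exact Submodule.smul_mem_pointwise_smul _ _ _ trivial)
  obtain ⟨e, hes', rfl⟩ := exists_lift_mkQ _ hes
  rw [kdiff_map] at he
  obtain ⟨g', hgs', hg'⟩ := exists_lift_quotSMulTop (f := f) (c := g - kdiff a e) (t := s + 1)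
    (fun W hW => by
      rw [Pi.sub_apply, hgs W hW, kdiff_apply_congr_card a hes' hW, sub_zero])
    (fun W => by rw [Pi.sub_apply, map_sub, sub_eq_zero]; exact (congrFun he W).symm)
  refine ⟨g', fun _ => trivial, hgs', ?_⟩
  have : f • kdiff a g' = f • c := by
    rw [← map_smul, ← hg', map_sub, kdiff_kdiff, sub_zero, hg]
  ext W
  exact hf (congrFun this W)

lemma KoszulExact.of_card_lt {s : ℕ} (hs : Fintype.card V < s) : KoszulExact a M s := by
  intro c _ hc _
  refine ⟨0, fun _ => trivial, fun _ _ => rfl, ?_⟩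
  rw [map_zero]
  ext W
  exact (hc W (by have := W.card_le_univ; omega)).symm

lemma koszulExact_of_isWeaklyRegular (rs : List A)
    (hmem : ∀ f ∈ rs, f ∈ Ideal.span (Set.range a)) (hreg : IsWeaklyRegular M rs) {s : ℕ}
    (hs : Fintype.card V < s + rs.length) : KoszulExact a M s := by
  induction rs generalizing M s with
  | nil => exact KoszulExact.of_card_lt a (by simpa using hs)
  | cons f rs ih =>
    obtain ⟨h1, h2⟩ := (isWeaklyRegular_cons_iff M f rs).1 hreg
    exact KoszulExact.of_quotSMulTop a (hmem f (by simp)) h1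
      (ih (fun g hg => hmem g (by simp [hg])) h2 (by simp at hs; omega))

lemma exists_isSMulRegular_of_koszulExact [IsNoetherianRing A] [Module.Finite A M]
    (h : KoszulExact a M (Fintype.card V)) :
    ∃ f ∈ Ideal.span (Set.range a), IsSMulRegular M f := by
  by_contra! hcon
  have hsub : ((Ideal.span (Set.range a) : Ideal A) : Set A) ⊆
      ⋃ p ∈ associatedPrimes A M, (p : Set A) := by
    rw [biUnion_associatedPrimes_eq_zero_divisors]
    intro f hf
    by_contra hf'
    refine hcon f hf ?_
    rw [isSMulRegular_iff_right_eq_zero_of_smul]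
    intro m hm
    by_contra hm0
    exact hf' ⟨m, hm0, hm⟩
  obtain ⟨p, hp, hle⟩ := (Ideal.subset_union_prime_finite (associatedPrimes.finite A M)
    (f := id) 0 0 fun _ h _ _ => h.isPrime).1 hsub
  rw [AssociatedPrimes.mem_iff, isAssociatedPrime_iff] at hp
  obtain ⟨hpr, m, rfl⟩ := hp
  have hm : m ≠ 0 := by
    rintro rfl
    exact hpr.ne_top (by simp)
  have ha : ∀ j, a j • m = 0 := fun j => by
    simpa using hle (Ideal.subset_span ⟨j, rfl⟩)
  obtain ⟨e, -, he, he'⟩ := h (fun W => if W.card = Fintype.card V then m else 0)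
    (fun _ => trivial) (fun W hW => if_neg hW) (by
      ext W
      rw [kdiff_apply]
      refine Finset.sum_eq_zero fun j _ => ?_
      by_cases hj : j ∈ W
      · rw [contr_of_mem hj, smul_zero]
      · rw [contr_of_notMem hj, smul_comm]
        split_ifs
        · rw [ha, smul_zero]
        · rw [smul_zero, smul_zero])
  have he0 : e = 0 := by
    ext W
    exact he W (by have := W.card_le_univ; omega)
  rw [he0, map_zero] at he'
  exact hm (by simpa using (congrFun he' Finset.univ).symm)

lemma exists_isWeaklyRegular_of_koszulExact [IsNoetherianRing A] [Module.Finite A M] (d : ℕ)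
    (hd : d ≤ Fintype.card V)     (h : ∀ s, Fintype.card V < s + d → KoszulExact a M s) :
    ∃ rs : List A, rs.length = d ∧ (∀ f ∈ rs, f ∈ Ideal.span (Set.range a)) ∧
      IsWeaklyRegular M rs := by
  induction d generalizing M with
  | zero => exact ⟨[], rfl, by simp, IsWeaklyRegular.nil A M⟩
  | succ d ih =>
    obtain ⟨f, hfa, hf⟩ := exists_isSMulRegular_of_koszulExact a (h _ (by omega))
    have : Module.Finite A (QuotSMulTop f M) := by infer_instance
    obtain ⟨rs, hl, hrs, hreg⟩ := ih (M := QuotSMulTop f M) (by omega) (by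
      intro s hs
      obtain ⟨s, rfl⟩ : ∃ t, s = t + 1 := ⟨s - 1, by omega⟩
      exact KoszulExact.quotSMulTop a hf (h _ (by omega)) (h _ (by omega)))
    exact ⟨f :: rs, by simp [hl], by simpa [hfa] using hrs,
      (isWeaklyRegular_cons_iff M f rs).2 ⟨hf, hreg⟩⟩

end Regular

end DS

namespace DS

/-! ### Koszul homology of monomial ideals -/

section Monomial

variable {V : Type*}

open MvPolynomial

variable {K : Type*} [Field K]

/-- The exponent vector of the squarefree monomial with support `W`. -/
noncomputable def ind (W : Finset V) : V →₀ ℕ := ∑ j ∈ W, Finsupp.single j 1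

/-- The component of multidegree `e` of a Koszul chain over the polynomial ring. -/
noncomputable def comp (e : V →₀ ℕ) (c : Finset V → MvPolynomial V K) : Finset V → K :=
  open Classical in fun W => if ind W ≤ e then coeff (e - ind W) (c W) else 0

lemma comp_of_le {e : V →₀ ℕ} {W : Finset V} (h : ind W ≤ e)
    (c : Finset V → MvPolynomial V K) : comp e c W = coeff (e - ind W) (c W) := if_pos h

lemma comp_of_not_le {e : V →₀ ℕ} {W : Finset V} (h : ¬ ind W ≤ e)
    (c : Finset V → MvPolynomial V K) : comp e c W = 0 := if_neg h

lemma comp_eq_zero {e : V →₀ ℕ} {W : Finset V} {c : Finset V → MvPolynomial V K}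
    (h : c W = 0) : comp e c W = 0 := by
  simp [comp, h]

lemma comp_add_ind (m : V →₀ ℕ) (W : Finset V) (c : Finset V → MvPolynomial V K) :
    comp (m + ind W) c W = coeff m (c W) := by
  rw [comp_of_le le_add_self, add_tsub_cancel_right]

lemma comp_injective {c c' : Finset V → MvPolynomial V K} (h : ∀ e, comp e c = comp e c') :
    c = c' := by
  ext W m
  rw [← comp_add_ind, h, comp_add_ind]

variable [LinearOrder V]

lemma ind_insert {j : V} {W : Finset V} (h : j ∉ W) :
    ind (insert j W) = ind W + Finsupp.single j 1 := by
  rw [ind, Finset.sum_insert h, add_comm, ind]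

lemma ind_apply (W : Finset V) (j : V) : ind W j = if j ∈ W then 1 else 0 := by
  simp [ind, Finsupp.finsetSum_apply, Finsupp.single_apply]

variable [Fintype V]

lemma koszulExact_quotient_iff {A : Type*} [CommRing A] (a : V → A) (I : Ideal A) {s : ℕ}
    (h0 : KoszulExact a A s) (h1 : KoszulExact a A (s + 1)) :
    KoszulExact a (A ⧸ I) (s + 1) ↔ KExact a (fun _ f => f ∈ I) s := by
  constructor
  · intro h g hgI hgs hg
    obtain ⟨c, -, hcs, rfl⟩ := h0 g (fun _ => trivial) hgs hg
    obtain ⟨e, -, hes, he⟩ := h (fun W => I.mkQ (c W)) (fun _ => trivial)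
      (fun W hW => by simp [hcs W hW]) (by
        rw [kdiff_map]
        ext W
        rw [Submodule.mkQ_apply, Pi.zero_apply, Submodule.Quotient.mk_eq_zero]
        exact hgI W)
    obtain ⟨e, hes', rfl⟩ := exists_lift_mkQ I hes
    rw [kdiff_map] at he
    refine ⟨c - kdiff a e, fun W => ?_, fun W hW => ?_, by rw [map_sub, kdiff_kdiff, sub_zero]⟩
    · show _ ∈ I
      rw [← Submodule.Quotient.mk_eq_zero, ← Submodule.mkQ_apply, Pi.sub_apply, map_sub,
        sub_eq_zero]
      exact (congrFun he W).symm
    · rw [Pi.sub_apply, hcs W hW, kdiff_apply_congr_card a hes' hW, sub_zero]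
  · intro h c _ hcs hc
    obtain ⟨c, hcs', rfl⟩ := exists_lift_mkQ I hcs
    rw [kdiff_map] at hc
    obtain ⟨g, hgI, hgs, hg⟩ := h (kdiff a c) (fun W => by
      show _ ∈ I
      rw [← Submodule.Quotient.mk_eq_zero, ← Submodule.mkQ_apply]
      exact congrFun hc W) (fun W hW => kdiff_apply_congr_card a hcs' hW) (kdiff_kdiff a c)
    obtain ⟨e, -, hes, he⟩ := h1 (c - g) (fun _ => trivial)
      (fun W hW => by rw [Pi.sub_apply, hcs' W hW, hgs W hW, sub_zero])
      (by rw [map_sub, hg, sub_self])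
    refine ⟨fun W => I.mkQ (e W), fun _ => trivial, fun W hW => by simp [hes W hW], ?_⟩
    rw [kdiff_map, he]
    ext W
    rw [Pi.sub_apply, map_sub, sub_eq_self, Submodule.mkQ_apply, Submodule.Quotient.mk_eq_zero]
    exact hgI W

lemma comp_kdiff (e : V →₀ ℕ) (c : Finset V → MvPolynomial V K) :
    comp e (kdiff (X : V → MvPolynomial V K) c) = kdiff (fun _ => (1 : K)) (comp e c) := by
  ext W
  rw [kdiff_apply]
  by_cases hW : ind W ≤ e
  · rw [comp_of_le hW, kdiff_apply, coeff_sum]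
    refine Finset.sum_congr rfl fun j _ => ?_
    by_cases hj : j ∈ W
    · rw [contr_of_mem hj, contr_of_mem hj]; simp
    rw [contr_of_notMem hj, contr_of_notMem hj, one_smul, smul_eq_mul, coeff_X_mul']
    have hiff : j ∈ (e - ind W).support ↔ ind (insert j W) ≤ e := by
      rw [ind_insert hj, ← le_tsub_iff_left hW, Finsupp.single_le_iff, Finsupp.mem_support_iff,
        Nat.one_le_iff_ne_zero]
    by_cases h : ind (insert j W) ≤ e
    · rw [if_pos (hiff.2 h), comp_of_le h, ind_insert hj, ← tsub_add_eq_tsub_tsub, coeff_smul]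
    · rw [if_neg (fun h' => h (hiff.1 h')), comp_of_not_le h, smul_zero]
  · rw [comp_of_not_le hW]
    refine (Finset.sum_eq_zero fun j _ => ?_).symm
    by_cases hj : j ∈ W
    · rw [contr_of_mem hj, smul_zero]
    · rw [contr_of_notMem hj, comp_of_not_le, smul_zero, smul_zero]
      intro h
      refine hW (le_trans ?_ h)
      rw [ind_insert hj]
      exact le_self_add

/-- Exactness at degree `s` (sets of size `s`) of the chain complex over `K` of a family of
finite sets. -/
abbrev FamilyExact (K : Type*) [Field K] (F : Finset V → Prop) (s : ℕ) : Prop :=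
  KExact (M := K) (fun _ : V => (1 : K)) (fun W k => k ≠ 0 → F W) s

/-- The upper Koszul simplicial complex, in multidegree `e`, of the monomial ideal with set of
exponents `P`. -/
def upperKoszul (P : (V →₀ ℕ) → Prop) (e : V →₀ ℕ) (W : Finset V) : Prop :=
  ind W ≤ e ∧ P (e - ind W)

variable {I : Ideal (MvPolynomial V K)} {P : (V →₀ ℕ) → Prop}

lemma kExact_ideal_of_familyExact (hI : ∀ f, f ∈ I ↔ ∀ m ∈ f.support, P m) {s : ℕ}
    (h : ∀ e, FamilyExact K (upperKoszul P e) s) :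
    KExact (X : V → MvPolynomial V K) (fun _ f => f ∈ I) s := by
  classical
  intro c hcI hcs hc
  have key : ∀ e, ∃ g : Finset V → K, (∀ W, g W ≠ 0 → upperKoszul P e W) ∧
      (∀ W, W.card ≠ s + 1 → g W = 0) ∧ kdiff (fun _ => (1 : K)) g = comp e c := by
    intro e
    refine h e (comp e c) (fun W hW => ?_) (fun W hW => comp_eq_zero (hcs W hW)) ?_
    · by_cases hle : ind W ≤ e
      · rw [comp_of_le hle] at hW
        exact ⟨hle, (hI _).1 (hcI W) _ (mem_support_iff.2 hW)⟩
      · exact absurd (comp_of_not_le hle c) hW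
    · rw [← comp_kdiff, hc]
      ext W
      exact comp_eq_zero rfl
  choose g hgP hgs hg using key
  let T : Finset (V →₀ ℕ) := Finset.univ.biUnion fun W => (c W).support.image (· + ind W)
  have hT : ∀ e ∉ T, comp e c = 0 := by
    intro e he
    ext W
    by_cases hle : ind W ≤ e
    · rw [comp_of_le hle]
      by_contra hne
      refine he (Finset.mem_biUnion.2 ⟨W, Finset.mem_univ _, Finset.mem_image.2
        ⟨e - ind W, mem_support_iff.2 hne, tsub_add_cancel_of_le hle⟩⟩)
    · exact comp_of_not_le hle c
  let E : Finset V → MvPolynomial V K := fun W => ∑ e ∈ T, monomial (e - ind W) (g e W)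
  have hE : ∀ e, comp e E = if e ∈ T then g e else 0 := by
    intro e
    ext W
    by_cases hle : ind W ≤ e
    · rw [comp_of_le hle, coeff_sum]
      have : ∀ e' ∈ T, coeff (e - ind W) (monomial (e' - ind W) (g e' W)) =
          if e' = e then g e' W else 0 := by
        intro e' _
        rw [coeff_monomial]
        by_cases hz : g e' W = 0
        · simp [hz]
        have hle' := (hgP e' W hz).1
        refine if_congr ⟨fun h => ?_, fun h => by rw [h]⟩ rfl rfl
        rw [← tsub_add_cancel_of_le hle', h, tsub_add_cancel_of_le hle]
      rw [Finset.sum_congr rfl this, Finset.sum_ite_eq']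
      split_ifs <;> rfl
    · rw [comp_of_not_le hle]
      split_ifs
      · by_contra hne
        exact hle (hgP e W (Ne.symm hne)).1
      · rfl
  refine ⟨E, fun W => Ideal.sum_mem _ fun e _ => (hI _).2 fun m hm => ?_, fun W hW => ?_,
    comp_injective fun e => ?_⟩
  · rw [mem_support_iff, coeff_monomial] at hm
    split_ifs at hm with h'
    · exact h' ▸ (hgP e W hm).2
    · exact absurd rfl hm
  · exact Finset.sum_eq_zero fun e _ => by rw [hgs e W hW, map_zero]
  · rw [comp_kdiff, hE]
    split_ifs with he
    · exact hg e
    · rw [map_zero, hT e he]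

lemma familyExact_of_kExact_ideal (hI : ∀ f, f ∈ I ↔ ∀ m ∈ f.support, P m) {s : ℕ}
    (h : KExact (X : V → MvPolynomial V K) (fun _ f => f ∈ I) s) (e : V →₀ ℕ) :
    FamilyExact K (upperKoszul P e) s := by
  classical
  intro c hcP hcs hc
  let C : Finset V → MvPolynomial V K := fun W => monomial (e - ind W) (c W)
  have hC : ∀ e', comp e' C = if e' = e then c else 0 := by
    intro e'
    ext W
    by_cases hz : c W = 0
    · rw [comp_eq_zero (by simp [C, hz])]
      split_ifs <;> simp [hz]
    have hle := (hcP W hz).1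
    by_cases hle' : ind W ≤ e'
    · rw [comp_of_le hle', coeff_monomial]
      have : e - ind W = e' - ind W ↔ e' = e :=
        ⟨fun h => by rw [← tsub_add_cancel_of_le hle', ← h, tsub_add_cancel_of_le hle],
          fun h => by rw [h]⟩
      by_cases he : e' = e
      · rw [if_pos (this.2 he), if_pos he]
      · rw [if_neg (fun h => he (this.1 h)), if_neg he, Pi.zero_apply]
    · rw [comp_of_not_le hle', if_neg (by rintro rfl; exact hle' hle), Pi.zero_apply]
  obtain ⟨E, hEI, hEs, hE⟩ := h C (fun W => (hI _).2 fun m hm => by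
      rw [mem_support_iff, coeff_monomial] at hm
      split_ifs at hm with h'
      · exact h' ▸ (hcP W hm).2
      · exact absurd rfl hm) (fun W hW => by simp [C, hcs W hW]) (comp_injective fun e' => by
      rw [comp_kdiff, hC]
      have : comp e' (0 : Finset V → MvPolynomial V K) = 0 := by
        ext W
        exact comp_eq_zero rfl
      rw [this]
      split_ifs
      · exact hc
      · rw [map_zero])
  refine ⟨comp e E, fun W hW => ?_, fun W hW => comp_eq_zero (hEs W hW), ?_⟩
  · by_cases hle : ind W ≤ e
    · rw [comp_of_le hle] at hW
      exact ⟨hle, (hI _).1 (hEI W) _ (mem_support_iff.2 hW)⟩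
    · exact absurd (comp_of_not_le hle E) hW
  · rw [← comp_kdiff, hE, hC, if_pos rfl]

end Monomial

end DS

namespace DS

/-! ### Chain complexes of families of finite sets -/

section Family

variable {V : Type*} [LinearOrder V] {M : Type*} [AddCommGroup M]

/-- The deletion of `x` from the family `F`. -/
def del (F : Finset V → Prop) (x : V) (W : Finset V) : Prop := x ∉ W ∧ F W

/-- The link of `x` in the family `F`. -/
def lk (F : Finset V → Prop) (x : V) (W : Finset V) : Prop := x ∉ W ∧ F (insert x W)

lemma contr_eq_zero_iff {x : V} {c : Finset V → M} :
    contr x c = 0 ↔ ∀ W, c W ≠ 0 → x ∉ W := by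
  constructor
  · intro h W hW hx
    have := congrFun (contr_wedge_self x c) W
    rw [h, map_zero, add_zero, contr_of_mem hx] at this
    exact hW this.symm
  · intro h
    ext W
    by_cases hx : x ∈ W
    · exact contr_of_mem hx c
    · rw [contr_of_notMem hx, Pi.zero_apply]
      by_contra hne
      exact h (insert x W) (fun h0 => hne (by rw [h0, smul_zero])) (Finset.mem_insert_self x W)

lemma contr_mem_lk {F : Finset V → Prop} {x : V} {c : Finset V → M}
    (hc : ∀ W, c W ≠ 0 → F W) (W : Finset V) (hW : contr x c W ≠ 0) : lk F x W := by
  by_cases hx : x ∈ W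
  · exact absurd (contr_of_mem hx c) hW
  · rw [contr_of_notMem hx] at hW
    exact ⟨hx, hc _ fun h => hW (by rw [h, smul_zero])⟩

lemma wedge_mem {F : Finset V → Prop} {x : V} {c : Finset V → M}
    (hc : ∀ W, c W ≠ 0 → F (insert x W)) (W : Finset V) (hW : wedge x c W ≠ 0) : F W := by
  by_cases hx : x ∈ W
  · rw [wedge_of_mem hx] at hW
    simpa [Finset.insert_erase hx] using hc (W.erase x) fun h => hW (by rw [h, smul_zero])
  · exact absurd (wedge_of_notMem hx c) hW

lemma contr_wedge_of_contr_eq_zero {x : V} {c : Finset V → M} (h : contr x c = 0) :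
    contr x (wedge x c) = c := by
  have := contr_wedge_self x c
  rwa [h, map_zero, add_zero] at this

variable [Fintype V] {K : Type*} [Field K] {F : Finset V → Prop}

lemma kdiff_one_wedge (x : V) (c : Finset V → K) :
    kdiff (fun _ => (1 : K)) (wedge x c) = c - wedge x (kdiff (fun _ => (1 : K)) c) := by
  rw [kdiff_wedge, one_smul]

lemma FamilyExact.of_cone {x : V} {s : ℕ}
    (h : ∀ W, W.card = s → F W → F (insert x W)) : FamilyExact K F s := by
  intro c hcF hcs hc
  refine ⟨wedge x c, wedge_mem fun W hW => ?_, fun W hW => wedge_eq_zero_of_card hcs x hW, ?_⟩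
  · by_cases hs : W.card = s
    · exact h W hs (hcF W hW)
    · exact absurd (hcs W hs) hW
  · rw [kdiff_one_wedge, hc, map_zero, sub_zero]

lemma FamilyExact.of_not {s : ℕ} (h : ∀ W, W.card = s → ¬ F W) : FamilyExact K F s := by
  intro c hcF hcs _
  refine ⟨0, fun W hW => absurd rfl hW, fun _ _ => rfl, ?_⟩
  rw [map_zero]
  ext W
  by_contra hne
  by_cases hs : W.card = s
  · exact h W hs (hcF W (Ne.symm hne))
  · exact hne (hcs W hs).symm

lemma FamilyExact.congr {F' : Finset V → Prop} (h : ∀ W, F W ↔ F' W) {s : ℕ}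
    (hF : FamilyExact K F s) : FamilyExact K F' s := by
  obtain rfl : F = F' := funext fun W => propext (h W)
  exact hF

lemma FamilyExact.of_del_of_lk (hF : ∀ U W, U ⊆ W → F W → F U) (x : V) {s : ℕ}
    (hdel : FamilyExact K (del F x) (s + 1)) (hlk : FamilyExact K (lk F x) s) :
    FamilyExact K F (s + 1) := by
  intro c hcF hcs hc
  obtain ⟨e, heF, hes, he⟩ := hlk (contr x c) (contr_mem_lk hcF)
    (fun W hW => contr_eq_zero_of_card hcs x hW) (by rw [← neg_eq_zero, ← contr_kdiff, hc, map_zero])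
  have hxe : contr x e = 0 := contr_eq_zero_iff.2 fun W hW => (heF W hW).1
  have hxc : contr x (c + e - wedge x (contr x c)) = 0 := by
    rw [map_sub, map_add, hxe, contr_wedge_of_contr_eq_zero (contr_contr_self x c)]
    abel
  have hw : ∀ W, wedge x (contr x c) W ≠ 0 → F W :=
    wedge_mem fun W hW => (contr_mem_lk hcF W hW).2
  obtain ⟨e', he'F, he's, he'⟩ := hdel (c + e - wedge x (contr x c)) (fun W hW => by
      refine ⟨contr_eq_zero_iff.1 hxc W hW, ?_⟩
      by_contra hFW
      refine hW ?_
      have h1 : c W = 0 := by_contra fun h => hFW (hcF W h)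
      have h2 : e W = 0 := by_contra fun h => hFW (hF _ _ (Finset.subset_insert x W) (heF W h).2)
      have h3 : wedge x (contr x c) W = 0 := by_contra fun h => hFW (hw W h)
      rw [Pi.sub_apply, Pi.add_apply, h1, h2, h3, add_zero, sub_zero])
    (fun W hW => by
      rw [Pi.sub_apply, Pi.add_apply, hcs W hW, hes W hW,
        wedge_eq_zero_of_card (fun W hW => contr_eq_zero_of_card hcs x hW) x hW]
      simp)
    (by rw [map_sub, map_add, hc, kdiff_one_wedge, he, ← he, kdiff_kdiff, map_zero]; simp)
  refine ⟨e' - wedge x e, fun W hW => ?_, fun W hW => ?_, ?_⟩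
  · by_contra hFW
    have h1 : e' W = 0 := by_contra fun h => hFW (he'F W h).2
    have h2 : wedge x e W = 0 := by_contra fun h =>
      hFW (wedge_mem (fun W hW => (heF W hW).2) W h)
    exact hW (by rw [Pi.sub_apply, h1, h2, sub_zero])
  · rw [Pi.sub_apply, he's W hW, wedge_eq_zero_of_card hes x hW, sub_zero]
  · rw [map_sub, kdiff_one_wedge, he', he]
    abel

lemma FamilyExact.del_of_lk (hF : ∀ U W, U ⊆ W → F W → F U) (x : V) {s : ℕ}
    (h : FamilyExact K F s) (hlk : FamilyExact K (lk F x) s) : FamilyExact K (del F x) s := by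
  intro c hcF hcs hc
  obtain ⟨e, heF, hes, he⟩ := h c (fun W hW => (hcF W hW).2) hcs hc
  have hxc : contr x c = 0 := contr_eq_zero_iff.2 fun W hW => (hcF W hW).1
  obtain ⟨g, hgF, hgs, hg⟩ := hlk (contr x e) (contr_mem_lk heF)
    (fun W hW => contr_eq_zero_of_card hes x hW)
    (by rw [← neg_eq_zero, ← contr_kdiff, he, hxc])
  have hxg : contr x g = 0 := contr_eq_zero_iff.2 fun W hW => (hgF W hW).1
  have hxe : contr x (e + g - wedge x (contr x e)) = 0 := by
    rw [map_sub, map_add, hxg, contr_wedge_of_contr_eq_zero (contr_contr_self x e)]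
    abel
  refine ⟨e + g - wedge x (contr x e), fun W hW => ⟨contr_eq_zero_iff.1 hxe W hW, ?_⟩,
    fun W hW => ?_, ?_⟩
  · by_contra hFW
    refine hW ?_
    have h1 : e W = 0 := by_contra fun h => hFW (heF W h)
    have h2 : g W = 0 := by_contra fun h => hFW (hF _ _ (Finset.subset_insert x W) (hgF W h).2)
    have h3 : wedge x (contr x e) W = 0 := by_contra fun h =>
      hFW (wedge_mem (fun W hW => (contr_mem_lk heF W hW).2) W h)
    rw [Pi.sub_apply, Pi.add_apply, h1, h2, h3, add_zero, sub_zero]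
  · rw [Pi.sub_apply, Pi.add_apply, hes W hW, hgs W hW,
      wedge_eq_zero_of_card (fun W hW => contr_eq_zero_of_card hes x hW) x hW]
    simp
  · rw [map_sub, map_add, kdiff_one_wedge, he, hg, ← hg, kdiff_kdiff, map_zero]
    simp

lemma FamilyExact.lk_of_del (hF : ∀ U W, U ⊆ W → F W → F U) (x : V) {s : ℕ}
    (hdel : FamilyExact K (del F x) s) (h : FamilyExact K F (s + 1)) :
    FamilyExact K (lk F x) s := by
  intro c hcF hcs hc
  obtain ⟨g, hgF, hgs, hg⟩ := hdel c
    (fun W hW => ⟨(hcF W hW).1, hF _ _ (Finset.subset_insert x W) (hcF W hW).2⟩) hcs hc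
  have hxc : contr x c = 0 := contr_eq_zero_iff.2 fun W hW => (hcF W hW).1
  have hxg : contr x g = 0 := contr_eq_zero_iff.2 fun W hW => (hgF W hW).1
  obtain ⟨e, heF, hes, he⟩ := h (wedge x c - g) (fun W hW => by
      by_contra hFW
      have h1 : g W = 0 := by_contra fun h => hFW (hgF W h).2
      have h2 : wedge x c W = 0 := by_contra fun h =>
        hFW (wedge_mem (fun W hW => (hcF W hW).2) W h)
      exact hW (by rw [Pi.sub_apply, h1, h2, sub_zero]))
    (fun W hW => by rw [Pi.sub_apply, hgs W hW, wedge_eq_zero_of_card hcs x hW, sub_zero])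
    (by rw [map_sub, kdiff_one_wedge, hc, hg, map_zero, sub_zero, sub_self])
  refine ⟨-contr x e, fun W hW => contr_mem_lk heF W fun h => hW (by rw [Pi.neg_apply, h, neg_zero]),
    fun W hW => by rw [Pi.neg_apply, contr_eq_zero_of_card hes x hW, neg_zero], ?_⟩
  rw [map_neg, ← contr_kdiff, he, map_sub, hxg, sub_zero, contr_wedge_of_contr_eq_zero hxc]

end Family

end DS

namespace DS

/-! ### Matchings and complexes of independent sets -/

section Independent

variable {V : Type*} (Γ : SimpleGraph V)

/-- `M` is a set of edges of `Γ` inside `X` such that vertices of different edges are related by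
`R`. -/
def RMatching (R : V → V → Prop) (X : Finset V) (M : Finset (V × V)) : Prop :=
  (∀ e ∈ M, e.1 ∈ X ∧ e.2 ∈ X ∧ Γ.Adj e.1 e.2) ∧
    ∀ e ∈ M, ∀ f ∈ M, e ≠ f → (R e.1 f.1 ∧ R e.1 f.2) ∧ R e.2 f.1 ∧ R e.2 f.2

/-- Two vertices are separated if they are distinct and not adjacent. -/
def Sep (x y : V) : Prop := x ≠ y ∧ ¬ Γ.Adj x y

/-- The family of independent subsets of `X`. -/
def indepFamily (X W : Finset V) : Prop := W ⊆ X ∧ ∀ u ∈ W, ∀ v ∈ W, ¬ Γ.Adj u v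

variable {Γ} {R : V → V → Prop} {X X' : Finset V} {M N : Finset (V × V)}

lemma Sep.symm {x y : V} (h : Sep Γ x y) : Sep Γ y x := ⟨h.1.symm, fun h' => h.2 h'.symm⟩

lemma RMatching.mono (h : RMatching Γ R X M) (hX : X ⊆ X') : RMatching Γ R X' M :=
  ⟨fun e he => ⟨hX (h.1 e he).1, hX (h.1 e he).2.1, (h.1 e he).2.2⟩, h.2⟩

lemma RMatching.subset (h : RMatching Γ R X M) (hN : N ⊆ M) : RMatching Γ R X N :=
  ⟨fun e he => h.1 e (hN he), fun e he f hf => h.2 e (hN he) f (hN hf)⟩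

lemma RMatching.ne (h : RMatching Γ (Sep Γ) X M) : RMatching Γ (· ≠ ·) X M :=
  ⟨h.1, fun e he f hf hef => ⟨⟨(h.2 e he f hf hef).1.1.1, (h.2 e he f hf hef).1.2.1⟩,
    (h.2 e he f hf hef).2.1.1, (h.2 e he f hf hef).2.2.1⟩⟩

lemma RMatching.insert [DecidableEq V] (hsymm : ∀ x y, R x y → R y x) (hirr : ∀ x, ¬ R x x)
    (h : RMatching Γ R X M) {u v : V} (hu : u ∈ X) (hv : v ∈ X) (huv : Γ.Adj u v)
    (hs : ∀ e ∈ M, (R u e.1 ∧ R u e.2) ∧ R v e.1 ∧ R v e.2) :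
    RMatching Γ R X (insert (u, v) M) ∧ (insert (u, v) M).card = M.card + 1 := by
  refine ⟨⟨fun e he => ?_, fun e he f hf hef => ?_⟩, ?_⟩
  · rcases Finset.mem_insert.1 he with rfl | he
    · exact ⟨hu, hv, huv⟩
    · exact h.1 e he
  · rcases Finset.mem_insert.1 he with rfl | he
    · rcases Finset.mem_insert.1 hf with rfl | hf
      · exact absurd rfl hef
      · exact hs f hf
    · rcases Finset.mem_insert.1 hf with rfl | hf
      · obtain ⟨⟨h1, h2⟩, h3, h4⟩ := hs e he
        exact ⟨⟨hsymm _ _ h1, hsymm _ _ h3⟩, hsymm _ _ h2, hsymm _ _ h4⟩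
      · exact h.2 e he f hf hef
  · exact Finset.card_insert_of_notMem fun hm => hirr u (hs _ hm).1.1

/-- Insertion into an ordinary matching. -/
lemma RMatching.insert_ne [DecidableEq V] (h : RMatching Γ (· ≠ ·) X M) {u v : V}
    (hu : u ∈ X) (hv : v ∈ X) (huv : Γ.Adj u v)
    (hs : ∀ e ∈ M, (u ≠ e.1 ∧ u ≠ e.2) ∧ v ≠ e.1 ∧ v ≠ e.2) :
    RMatching Γ (· ≠ ·) X (Insert.insert (u, v) M) ∧
      (Insert.insert (u, v) M).card = M.card + 1 :=
  h.insert (fun _ _ h => h.symm) (fun _ h => h rfl) hu hv huv hs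

open Classical in
/-- The vertices of `X` outside the closed neighbourhood of `x`. -/
noncomputable def farFrom (Γ : SimpleGraph V) (X : Finset V) (x : V) : Finset V :=
  {w ∈ X | Sep Γ x w}

lemma mem_farFrom {x w : V} : w ∈ farFrom Γ X x ↔ w ∈ X ∧ Sep Γ x w := by
  simp [farFrom]

lemma farFrom_subset (x : V) : farFrom Γ X x ⊆ X := fun _ h => (mem_farFrom.1 h).1

lemma card_farFrom_lt {x : V} (hx : x ∈ X) : (farFrom Γ X x).card < X.card :=
  Finset.card_lt_card ⟨farFrom_subset x, fun h => (mem_farFrom.1 (h hx)).2.1 rfl⟩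

lemma indepFamily_subset (U W : Finset V) (hUW : U ⊆ W) (h : indepFamily Γ X W) :
    indepFamily Γ X U :=
  ⟨hUW.trans h.1, fun u hu v hv => h.2 u (hUW hu) v (hUW hv)⟩

lemma indepFamily_insert [DecidableEq V] {W : Finset V} {x : V} (hx : x ∈ X)
    (h : indepFamily Γ X W) (hxW : ∀ w ∈ W, ¬ Γ.Adj x w) : indepFamily Γ X (insert x W) := by
  refine ⟨Finset.insert_subset hx h.1, fun u hu v hv => ?_⟩
  rcases Finset.mem_insert.1 hu with rfl | hu' <;> rcases Finset.mem_insert.1 hv with rfl | hv'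
  · exact Γ.loopless.irrefl _
  · exact hxW v hv'
  · exact fun h => hxW u hu' h.symm
  · exact h.2 u hu' v hv'

variable [LinearOrder V]

lemma del_indepFamily (x : V) (W : Finset V) :
    del (indepFamily Γ X) x W ↔ indepFamily Γ (X.erase x) W := by
  constructor
  · rintro ⟨hx, hW, h⟩
    exact ⟨fun w hw => Finset.mem_erase.2 ⟨fun h => hx (h ▸ hw), hW hw⟩, h⟩
  · rintro ⟨hW, h⟩
    exact ⟨fun hx => (Finset.mem_erase.1 (hW hx)).1 rfl,
      fun w hw => (Finset.mem_erase.1 (hW hw)).2, h⟩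

lemma lk_indepFamily {x : V} (hx : x ∈ X) (W : Finset V) :
    lk (indepFamily Γ X) x W ↔ indepFamily Γ (farFrom Γ X x) W := by
  constructor
  · rintro ⟨hxW, hW, h⟩
    refine ⟨fun w hw => mem_farFrom.2 ⟨hW (Finset.mem_insert_of_mem hw),
      fun h => hxW (h ▸ hw), h x (Finset.mem_insert_self x W) w (Finset.mem_insert_of_mem hw)⟩,
      fun u hu v hv => h u (Finset.mem_insert_of_mem hu) v (Finset.mem_insert_of_mem hv)⟩
  · rintro ⟨hW, h⟩
    exact ⟨fun hxW => (mem_farFrom.1 (hW hxW)).2.1 rfl,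
      indepFamily_insert hx ⟨fun w hw => (mem_farFrom.1 (hW hw)).1, h⟩
        fun w hw => (mem_farFrom.1 (hW hw)).2.2⟩

variable [Fintype V] {K : Type*} [Field K]

lemma exists_adj_of_not_familyExact {s : ℕ} (h : ¬ FamilyExact K (indepFamily Γ X) s) {x : V}
    (hx : x ∈ X) : ∃ y ∈ X, Γ.Adj x y := by
  by_contra! hxy
  exact h (FamilyExact.of_cone fun W _ hW => indepFamily_insert hx hW fun w hw => hxy w (hW.1 hw))

lemma not_familyExact_erase_or_farFrom {s : ℕ} {x : V} (hx : x ∈ X)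
    (h : ¬ FamilyExact K (indepFamily Γ X) (s + 1)) :
    ¬ FamilyExact K (indepFamily Γ (X.erase x)) (s + 1) ∨
      ¬ FamilyExact K (indepFamily Γ (farFrom Γ X x)) s := by
  by_contra! hc
  exact h (FamilyExact.of_del_of_lk indepFamily_subset x
    (hc.1.congr fun W => (del_indepFamily x W).symm)
    (hc.2.congr fun W => (lk_indepFamily hx W).symm))

lemma nonempty_of_not_familyExact {s : ℕ} (h : ¬ FamilyExact K (indepFamily Γ X) (s + 1)) :
    X.Nonempty := by
  rw [Finset.nonempty_iff_ne_empty]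
  rintro rfl
  refine h (FamilyExact.of_not fun W hW hF => ?_)
  rw [Finset.subset_empty.1 hF.1] at hW
  simp at hW

/-- If the complex of independent sets has homology in degree `s`, the graph has a matching of
size `s`. -/
theorem exists_matching_of_not_familyExact : ∀ (n : ℕ) (X : Finset V) (s : ℕ), X.card = n →
    ¬ FamilyExact K (indepFamily Γ X) s → ∃ M, RMatching Γ (· ≠ ·) X M ∧ M.card = s := by
  intro n
  induction n using Nat.strong_induction_on with
  | _ n ih =>
  rintro X (_ | s) rfl h
  · exact ⟨∅, ⟨by simp, by simp⟩, rfl⟩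
  obtain ⟨x, hx⟩ := nonempty_of_not_familyExact h
  rcases not_familyExact_erase_or_farFrom hx h with h' | h'
  · obtain ⟨M, hM, hs⟩ := ih _ (Finset.card_erase_lt_of_mem hx) _ _ rfl h'
    exact ⟨M, hM.mono (Finset.erase_subset x X), hs⟩
  · obtain ⟨y, hy, hxy⟩ := exists_adj_of_not_familyExact h hx
    obtain ⟨M, hM, rfl⟩ := ih _ (card_farFrom_lt hx) _ _ rfl h'
    have hfar : ∀ w ∈ farFrom Γ X x, x ≠ w ∧ y ≠ w := fun w hw =>
      ⟨(mem_farFrom.1 hw).2.1, fun h => (mem_farFrom.1 hw).2.2 (h ▸ hxy)⟩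
    exact ⟨_, (hM.mono (farFrom_subset x)).insert_ne hx hy hxy fun e he =>
      ⟨⟨(hfar _ (hM.1 e he).1).1, (hfar _ (hM.1 e he).2.1).1⟩,
        (hfar _ (hM.1 e he).1).2, (hfar _ (hM.1 e he).2.1).2⟩⟩

lemma false_of_adj_inducedMatching
    (hC : ∀ x y a b w, Γ.Adj x y → Γ.Adj y a → Γ.Adj a b → Γ.Adj b w → Γ.Adj w x →
      x ≠ a → x ≠ b → y ≠ b → y ≠ w → a ≠ w → False)
    {t : ℕ} (hmax : ∀ M, RMatching Γ (· ≠ ·) X M → M.card ≠ t + 2)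
    {x y y' a b : V} (hx : x ∈ X) (hy : y ∈ X) (hy' : y' ∈ X) (hxy : Γ.Adj x y)
    (hxy' : Γ.Adj x y') (hyy' : y ≠ y') (hM : RMatching Γ (Sep Γ) (farFrom Γ X x) M)
    (hMt : M.card = t) {e : V × V} (he : e ∈ M) (ha : a ∈ farFrom Γ X x) (hb : b ∈ farFrom Γ X x)
    (hab : Γ.Adj a b) (hw : ∀ w, (w = e.1 ∨ w = e.2) → w = a ∨ w = b)
    (hsep : ∀ f ∈ M, f ≠ e → (Sep Γ a f.1 ∧ Sep Γ a f.2) ∧ Sep Γ b f.1 ∧ Sep Γ b f.2)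
    (hya : Γ.Adj y a) (hdel : ¬ FamilyExact K (indepFamily Γ (farFrom Γ X y)) t) : False := by
  obtain ⟨haX, hxa, hxa'⟩ := mem_farFrom.1 ha
  obtain ⟨hbX, hxb, hxb'⟩ := mem_farFrom.1 hb
  have hne : ∀ z w, Γ.Adj x z → w ∈ farFrom Γ X x → z ≠ w := fun z w hz hw h =>
    (mem_farFrom.1 hw).2.2 (h ▸ hz)
  have hN : ∀ w ∈ X, Γ.Adj b w → w = a ∨ w = y := by
    intro w hwX hbw
    by_contra! hc
    by_cases hxw : Γ.Adj x w
    · exact hC x y a b w hxy hya hab hbw hxw.symm hxa hxb (hne y b hxy hb) hc.2.symm hc.1.symm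
    have hxw' : x ≠ w := fun h => hxb' (h ▸ hbw.symm)
    have hwf : w ∈ farFrom Γ X x := mem_farFrom.2 ⟨hwX, hxw', hxw⟩
    have hwM : ∀ f ∈ M.erase e, w ≠ f.1 ∧ w ≠ f.2 := fun f hf => by
      obtain ⟨hfe, hf⟩ := Finset.mem_erase.1 hf
      exact ⟨fun h => (hsep f hf hfe).2.1.2 (h ▸ hbw), fun h => (hsep f hf hfe).2.2.2 (h ▸ hbw)⟩
    have h0 := (hM.ne.mono (farFrom_subset x)).subset (Finset.erase_subset e M)
    have hmem : ∀ f ∈ M.erase e, f.1 ∈ farFrom Γ X x ∧ f.2 ∈ farFrom Γ X x := fun f hf =>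
      ⟨(hM.1 f (Finset.mem_of_mem_erase hf)).1, (hM.1 f (Finset.mem_of_mem_erase hf)).2.1⟩
    obtain ⟨h1, h1c⟩ := h0.insert_ne hx hy' hxy' fun f hf =>
      ⟨⟨(mem_farFrom.1 (hmem f hf).1).2.1, (mem_farFrom.1 (hmem f hf).2).2.1⟩,
        hne _ _ hxy' (hmem f hf).1, hne _ _ hxy' (hmem f hf).2⟩
    obtain ⟨h2, h2c⟩ := h1.insert_ne hy haX hya fun f hf => by
      rcases Finset.mem_insert.1 hf with rfl | hf
      · exact ⟨⟨hxy.ne', hyy'⟩, hxa.symm, (hne _ _ hxy' ha).symm⟩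
      · have := hsep f (Finset.mem_of_mem_erase hf) (Finset.ne_of_mem_erase hf)
        exact ⟨⟨hne _ _ hxy (hmem f hf).1, hne _ _ hxy (hmem f hf).2⟩, this.1.1.1, this.1.2.1⟩
    obtain ⟨h3, h3c⟩ := h2.insert_ne hbX hwX hbw fun f hf => by
      rcases Finset.mem_insert.1 hf with rfl | hf
      · exact ⟨⟨(hne _ _ hxy hb).symm, hab.ne'⟩, hc.2, hc.1⟩
      rcases Finset.mem_insert.1 hf with rfl | hf
      · exact ⟨⟨hxb.symm, (hne _ _ hxy' hb).symm⟩, hxw'.symm, (hne _ _ hxy' hwf).symm⟩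
      · have := hsep f (Finset.mem_of_mem_erase hf) (Finset.ne_of_mem_erase hf)
        exact ⟨⟨this.2.1.1, this.2.2.1⟩, hwM f hf⟩
    refine hmax _ h3 ?_
    have := Finset.card_erase_add_one he
    omega
  obtain ⟨N, hNm, hNc⟩ := exists_matching_of_not_familyExact _ _ _ rfl hdel
  have hNf : ∀ f ∈ N, (f.1 ≠ b) ∧ f.2 ≠ b := fun f hf => by
    obtain ⟨h1, h2, h12⟩ := hNm.1 f hf
    have key : ∀ w ∈ farFrom Γ X y, ¬ Γ.Adj b w := fun w hw hbw => by
      obtain ⟨hwX, hw1, hw2⟩ := mem_farFrom.1 hw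
      rcases hN w hwX hbw with rfl | rfl
      · exact hw2 hya
      · exact hw1 rfl
    exact ⟨fun h => key _ h2 (h ▸ h12), fun h => key _ h1 (h ▸ h12.symm)⟩
  have hfy : ∀ z w, Γ.Adj y z → w ∈ farFrom Γ X y → z ≠ w := fun z w hz hw h =>
    (mem_farFrom.1 hw).2.2 (h ▸ hz)
  obtain ⟨h1, h1c⟩ := (hNm.mono (farFrom_subset y)).insert_ne haX hbX hab fun f hf =>
    ⟨⟨hfy _ _ hya (hNm.1 f hf).1, hfy _ _ hya (hNm.1 f hf).2.1⟩,
      (hNf f hf).1.symm, (hNf f hf).2.symm⟩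
  obtain ⟨h2, h2c⟩ := h1.insert_ne hx hy hxy fun f hf => by
    rcases Finset.mem_insert.1 hf with rfl | hf
    · exact ⟨⟨hxa, hxb⟩, hne _ _ hxy ha, hne _ _ hxy hb⟩
    · exact ⟨⟨hfy _ _ hxy.symm (hNm.1 f hf).1, hfy _ _ hxy.symm (hNm.1 f hf).2.1⟩,
        (mem_farFrom.1 (hNm.1 f hf).1).2.1, (mem_farFrom.1 (hNm.1 f hf).2.1).2.1⟩
  exact hmax _ h2 (by omega)

/-- In a graph without cycles of length five, homology of the complex of independent sets in the
degree of the matching number forces an induced matching of that size. -/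
theorem exists_inducedMatching_of_not_familyExact
    (hC : ∀ x y a b w, Γ.Adj x y → Γ.Adj y a → Γ.Adj a b → Γ.Adj b w → Γ.Adj w x →
      x ≠ a → x ≠ b → y ≠ b → y ≠ w → a ≠ w → False) :
    ∀ (n : ℕ) (X : Finset V) (s : ℕ), X.card = n →
    (∀ M, RMatching Γ (· ≠ ·) X M → M.card ≠ s + 1) →
    ¬ FamilyExact K (indepFamily Γ X) s → ∃ M, RMatching Γ (Sep Γ) X M ∧ M.card = s := by
  intro n
  induction n using Nat.strong_induction_on with
  | _ n ih =>
  rintro X (_ | t) rfl hmax h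
  · exact ⟨∅, ⟨by simp, by simp⟩, rfl⟩
  by_cases herase : ∃ x ∈ X, ¬ FamilyExact K (indepFamily Γ (X.erase x)) (t + 1)
  · obtain ⟨x, hx, hxe⟩ := herase
    obtain ⟨M, hM, hs⟩ := ih _ (Finset.card_erase_lt_of_mem hx) _ _ rfl
      (fun M hM => hmax M (hM.mono (Finset.erase_subset x X))) hxe
    exact ⟨M, hM.mono (Finset.erase_subset x X), hs⟩
  push Not at herase
  have hfar : ∀ x ∈ X, ¬ FamilyExact K (indepFamily Γ (farFrom Γ X x)) t := fun x hx =>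
    (not_familyExact_erase_or_farFrom hx h).resolve_left fun h' => h' (herase x hx)
  by_cases hdeg : ∀ x ∈ X, ∀ y ∈ X, ∀ z ∈ X, Γ.Adj x y → Γ.Adj x z → y = z
  · obtain ⟨M, hM, hs⟩ := exists_matching_of_not_familyExact _ _ _ rfl h
    refine ⟨M, ⟨hM.1, fun e he f hf hef => ?_⟩, hs⟩
    obtain ⟨⟨h1, h2⟩, h3, h4⟩ := hM.2 e he f hf hef
    obtain ⟨e1, e2, ea⟩ := hM.1 e he
    obtain ⟨f1, f2, fa⟩ := hM.1 f hf
    exact ⟨⟨⟨h1, fun h => h3 (hdeg _ e1 _ e2 _ f1 ea h)⟩,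
      ⟨h2, fun h => h4 (hdeg _ e1 _ e2 _ f2 ea h)⟩⟩,
      ⟨h3, fun h => h1 (hdeg _ e2 _ e1 _ f1 ea.symm h)⟩,
      ⟨h4, fun h => h2 (hdeg _ e2 _ e1 _ f2 ea.symm h)⟩⟩
  push Not at hdeg
  obtain ⟨x, hx, y, hy, y', hy', hxy, hxy', hyy'⟩ := hdeg
  obtain ⟨M, hM, hs⟩ := ih _ (card_farFrom_lt hx) _ t rfl (fun M hM hMt => by
    have hne : ∀ w ∈ farFrom Γ X x, y ≠ w := fun w hw h => (mem_farFrom.1 hw).2.2 (h ▸ hxy)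
    obtain ⟨h1, h1c⟩ := (hM.mono (farFrom_subset x)).insert_ne hx hy hxy fun f hf =>
      ⟨⟨(mem_farFrom.1 (hM.1 f hf).1).2.1, (mem_farFrom.1 (hM.1 f hf).2.1).2.1⟩,
        hne _ (hM.1 f hf).1, hne _ (hM.1 f hf).2.1⟩
    exact hmax _ h1 (by omega)) (hfar x hx)
  have hMX := hM.mono (farFrom_subset (X := X) x)
  by_cases hadj : ∀ e ∈ M, ¬ Γ.Adj y e.1 ∧ ¬ Γ.Adj y e.2
  · obtain ⟨h1, h1c⟩ := hMX.insert (fun _ _ h => h.symm) (fun _ h => h.1 rfl) hx hy hxy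
      fun f hf => ⟨⟨(mem_farFrom.1 (hM.1 f hf).1).2, (mem_farFrom.1 (hM.1 f hf).2.1).2⟩,
        ⟨fun h => (mem_farFrom.1 (hM.1 f hf).1).2.2 (h ▸ hxy), (hadj f hf).1⟩,
        ⟨fun h => (mem_farFrom.1 (hM.1 f hf).2.1).2.2 (h ▸ hxy), (hadj f hf).2⟩⟩
    exact ⟨_, h1, by omega⟩
  push Not at hadj
  obtain ⟨e, he, hye⟩ := hadj
  exfalso
  obtain ⟨he1, he2, hea⟩ := hM.1 e he
  by_cases hy1 : Γ.Adj y e.1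
  · exact false_of_adj_inducedMatching hC hmax hx hy hy' hxy hxy' hyy' hM hs he he1 he2 hea
      (fun w hw => hw) (fun f hf hfe => hM.2 e he f hf hfe.symm) hy1 (hfar y hy)
  · exact false_of_adj_inducedMatching hC hmax hx hy hy' hxy hxy' hyy' hM hs he he2 he1 hea.symm
      (fun w hw => hw.symm) (fun f hf hfe => (hM.2 e he f hf hfe.symm).symm) (hye hy1) (hfar y hy)

/-- The complex of independent sets of a disjoint union of `s` edges has homology in degree `s`. -/
theorem not_familyExact_of_inducedMatching (M : Finset (V × V)) : ∀ X : Finset V,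
    RMatching Γ (Sep Γ) X M → (∀ x ∈ X, ∃ e ∈ M, x = e.1 ∨ x = e.2) →
    ¬ FamilyExact K (indepFamily Γ X) M.card := by
  induction M using Finset.induction_on with
  | empty =>
    intro X _ hX h
    obtain rfl : X = ∅ := Finset.eq_empty_of_forall_notMem fun x hx => by
      obtain ⟨e, he, _⟩ := hX x hx
      simp at he
    obtain ⟨e, heF, hes, he⟩ := h (Pi.single ∅ 1) (fun W hW => by
        obtain rfl : W = ∅ := by
          by_contra hne
          exact hW (Pi.single_eq_of_ne hne _)
        exact ⟨le_rfl, by simp⟩)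
      (fun W hW => Pi.single_eq_of_ne (fun h => hW (congrArg _ h)) _) (by
        ext W
        rw [kdiff_apply]
        refine Finset.sum_eq_zero fun j _ => ?_
        by_cases hj : j ∈ W
        · rw [contr_of_mem hj, smul_zero]
        · rw [contr_of_notMem hj, Pi.single_eq_of_ne (Finset.insert_ne_empty j W), smul_zero,
            smul_zero])
    have h0 : e = 0 := by
      ext W
      by_contra hne
      obtain rfl := Finset.subset_empty.1 (heF W hne).1
      exact hne (hes _ (by simp))
    rw [h0, map_zero] at he
    simpa using congrFun he ∅
  | insert e M heM ih =>
    intro X hM hX h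
    rw [Finset.card_insert_of_notMem heM] at h
    obtain ⟨h1, h2, h12⟩ := hM.1 e (Finset.mem_insert_self e M)
    have hsub : RMatching Γ (Sep Γ) X M := hM.subset (Finset.subset_insert e M)
    have hse : ∀ f ∈ M, _ := fun f hf => hM.2 e (Finset.mem_insert_self e M) f
      (Finset.mem_insert_of_mem hf) (fun h => heM (h ▸ hf))
    have hcone : FamilyExact K (del (indepFamily Γ X) e.1) M.card := by
      refine FamilyExact.of_cone (x := e.2) fun W _ hW => ⟨?_, ?_⟩
      · rw [Finset.mem_insert, not_or]
        exact ⟨h12.ne, hW.1⟩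
      · refine indepFamily_insert h2 hW.2 fun w hw hwe => ?_
        obtain ⟨f, hf, hwf⟩ := hX w (hW.2.1 hw)
        rcases Finset.mem_insert.1 hf with rfl | hf
        · rcases hwf with rfl | rfl
          · exact hW.1 hw
          · exact hwe.ne rfl
        · rcases hwf with rfl | rfl
          · exact (hse f hf).2.1.2 hwe
          · exact (hse f hf).2.2.2 hwe
    refine ih (farFrom Γ X e.1) ⟨fun f hf => ⟨?_, ?_, (hsub.1 f hf).2.2⟩, hsub.2⟩ (fun x hx => ?_)
      ((FamilyExact.lk_of_del indepFamily_subset e.1 hcone h).congr (lk_indepFamily h1))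
    · exact mem_farFrom.2 ⟨(hsub.1 f hf).1, (hse f hf).1.1⟩
    · exact mem_farFrom.2 ⟨(hsub.1 f hf).2.1, (hse f hf).1.2⟩
    · obtain ⟨hxX, hx1, hx2⟩ := mem_farFrom.1 hx
      obtain ⟨f, hf, hxf⟩ := hX x hxX
      rcases Finset.mem_insert.1 hf with rfl | hf
      · rcases hxf with rfl | rfl
        · exact absurd rfl hx1
        · exact absurd h12 hx2
      · exact ⟨f, hf, hxf⟩

end Independent

end DS

namespace DS

/-! ### Symbolic powers of cover ideals and depth -/

section SymbolicPower

open MvPolynomial RingTheory.Sequence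

variable {V : Type*} {K : Type*} [Field K]

/-- The exponents of the monomials in the `n`-th symbolic power of the cover ideal. -/
def IsCover (G : SimpleGraph V) (n : ℕ) (m : V →₀ ℕ) : Prop :=
  ∀ u v, G.Adj u v → n ≤ m u + m v

variable (K) in
/-- The polynomials all of whose monomials have degree at least `n` in the variables `u`, `v`. -/
def pairIdeal (u v : V) (n : ℕ) : Ideal (MvPolynomial V K) where
  carrier := {f | ∀ m ∈ f.support, n ≤ m u + m v}
  zero_mem' := by simp
  add_mem' {f g} hf hg m hm := by
    classical
    rcases Finset.mem_union.1 (support_add hm) with h | h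
    · exact hf m h
    · exact hg m h
  smul_mem' f g hg m hm := by
    classical
    obtain ⟨a, -, b, hb, rfl⟩ := Finset.mem_add.1 (support_mul f g hm)
    have := hg b hb
    simp only [Finsupp.add_apply]
    omega

lemma pairIdeal_mul_le (u v : V) (n k : ℕ) :
    pairIdeal K u v n * pairIdeal K u v k ≤ pairIdeal K u v (n + k) := by
  classical
  refine Ideal.mul_le.2 fun f hf g hg m hm => ?_
  obtain ⟨a, ha, b, hb, rfl⟩ := Finset.mem_add.1 (support_mul f g hm)
  have h1 := hf a ha
  have h2 := hg b hb
  simp only [Finsupp.add_apply]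
  omega

lemma span_pair_pow {u v : V} (huv : u ≠ v) (n : ℕ) :
    (Ideal.span {X u, X v} : Ideal (MvPolynomial V K)) ^ n = pairIdeal K u v n := by
  classical
  apply le_antisymm
  · induction n with
    | zero => exact fun f _ m _ => Nat.zero_le _
    | succ n ih =>
      rw [pow_succ]
      refine (Ideal.mul_mono ih ?_).trans (pairIdeal_mul_le u v n 1)
      rw [Ideal.span_le]
      rintro f (rfl | rfl) m hm <;> rw [support_X, Finset.mem_singleton] at hm <;> subst hm <;> simp
  · intro f hf
    rw [f.as_sum]
    refine Ideal.sum_mem _ fun m hm => ?_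
    have hle : Finsupp.single u (m u) + Finsupp.single v (m v) ≤ m := by
      intro w
      by_cases hu : u = w
      · subst hu
        simp [Finsupp.single_eq_of_ne huv]
      · by_cases hv : v = w
        · subst hv
          simp [Finsupp.single_eq_of_ne huv.symm]
        · simp [hu, hv]
    have heq : monomial m (coeff m f) =
        monomial (m - (Finsupp.single u (m u) + Finsupp.single v (m v))) (coeff m f) *
          (X u ^ m u * X v ^ m v) := by
      rw [X_pow_eq_monomial, X_pow_eq_monomial, monomial_mul, monomial_mul, mul_one, mul_one,
        tsub_add_cancel_of_le hle]
    rw [heq]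
    refine Ideal.mul_mem_left _ _ (Ideal.pow_le_pow_right (hf m hm) ?_)
    rw [pow_add]
    exact Ideal.mul_mem_mul (Ideal.pow_mem_pow (Ideal.subset_span (by simp)) _)
      (Ideal.pow_mem_pow (Ideal.subset_span (by simp)) _)

lemma mem_symbPow {G : SimpleGraph V} {n : ℕ} (f : MvPolynomial V K) :
    f ∈ symbPow K G n ↔ ∀ m ∈ f.support, IsCover G n m := by
  simp only [symbPow, Submodule.mem_iInf, IsCover]
  constructor
  · intro h m hm u v huv
    have := h (u, v) huv
    rw [span_pair_pow huv.ne] at this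
    exact this m hm
  · rintro h ⟨u, v⟩ huv
    rw [span_pair_pow huv.ne]
    exact fun m hm => h m hm u v huv

lemma constantCoeff_of_mem_symbPow {G : SimpleGraph V} {u v : V} (huv : G.Adj u v) {n : ℕ}
    (hn : 1 ≤ n) {f : MvPolynomial V K} (hf : f ∈ symbPow K G n) : constantCoeff f = 0 := by
  rw [constantCoeff_eq]
  by_contra hne
  have := (mem_symbPow f).1 hf 0 (mem_support_iff.2 hne) u v huv
  simp at this
  omega

variable {I : Ideal (MvPolynomial V K)}

lemma lift_constantCoeff_smul (hI : ∀ f ∈ I, constantCoeff f = 0) (r : MvPolynomial V K)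
    (y : MvPolynomial V K ⧸ I) : Ideal.Quotient.lift I constantCoeff hI (r • y) =
      constantCoeff r * Ideal.Quotient.lift I constantCoeff hI y := by
  obtain ⟨g, rfl⟩ := Ideal.Quotient.mk_surjective y
  exact map_mul constantCoeff r g

lemma constantCoeff_of_mem_span_X {f : MvPolynomial V K}
    (hf : f ∈ Ideal.span (Set.range (X : V → MvPolynomial V K))) : constantCoeff f = 0 := by
  have : Ideal.span (Set.range (X : V → MvPolynomial V K)) ≤
      RingHom.ker (constantCoeff : MvPolynomial V K →+* K) := by
    rw [Ideal.span_le]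
    rintro _ ⟨j, rfl⟩
    exact constantCoeff_X _ j
  exact this hf

lemma isRegular_of_isWeaklyRegular (hI : ∀ f ∈ I, constantCoeff f = 0)
    {rs : List (MvPolynomial V K)}
    (hm : ∀ f ∈ rs, f ∈ Ideal.span (Set.range (X : V → MvPolynomial V K)))
    (h : IsWeaklyRegular (MvPolynomial V K ⧸ I) rs) : IsRegular (MvPolynomial V K ⧸ I) rs := by
  refine ⟨h, fun htop => ?_⟩
  have h1 : (1 : MvPolynomial V K ⧸ I) ∈ Ideal.ofList rs •
      (⊤ : Submodule (MvPolynomial V K) (MvPolynomial V K ⧸ I)) := htop ▸ Submodule.mem_top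
  have key : ∀ x ∈ Ideal.ofList rs •
      (⊤ : Submodule (MvPolynomial V K) (MvPolynomial V K ⧸ I)),
      Ideal.Quotient.lift I constantCoeff hI x = 0 := by
    intro x hx
    refine Submodule.smul_induction_on hx (fun r hr y _ => ?_) (fun x y hx hy => ?_)
    · rw [lift_constantCoeff_smul]
      have : Ideal.ofList rs ≤ RingHom.ker (constantCoeff : MvPolynomial V K →+* K) :=
        Ideal.span_le.2 fun f hf => constantCoeff_of_mem_span_X (hm f hf)
      rw [show constantCoeff r = 0 from this hr, zero_mul]
    · rw [map_add, hx, hy, add_zero]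
  have := key 1 h1
  rw [map_one] at this
  exact one_ne_zero this

end SymbolicPower

section Depth

open MvPolynomial RingTheory.Sequence

variable {V : Type*} [LinearOrder V] [Fintype V] {K : Type*} [Field K]

lemma koszulExact_mvPolynomial (s : ℕ) :
    KoszulExact (X : V → MvPolynomial V K) (MvPolynomial V K) (s + 1) := by
  have h : ∀ e : V →₀ ℕ, FamilyExact K (upperKoszul (fun _ => True) e) (s + 1) := by
    intro e
    by_cases he : e = 0
    · refine FamilyExact.of_not fun W hW hF => ?_
      obtain ⟨j, hj⟩ : W.Nonempty := Finset.card_pos.1 (by omega)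
      have := hF.1 j
      rw [ind_apply, if_pos hj, he] at this
      simp at this
    · obtain ⟨j, hj⟩ := Finsupp.ne_iff.1 he
      refine FamilyExact.of_cone (x := j) fun W _ hW => ⟨fun w => ?_, trivial⟩
      by_cases hwj : w = j
      · subst hwj
        rw [ind_apply, if_pos (Finset.mem_insert_self _ _)]
        exact Nat.one_le_iff_ne_zero.2 hj
      · have := hW.1 w
        rw [ind_apply] at this
        rw [ind_apply]
        simpa [hwj] using this
  intro c _ hcs hc
  obtain ⟨e, -, hes, he⟩ := kExact_ideal_of_familyExact (I := (⊤ : Ideal (MvPolynomial V K)))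
    (by simp) h c (fun _ => Submodule.mem_top) hcs hc
  exact ⟨e, fun _ => trivial, hes, he⟩

variable {I : Ideal (MvPolynomial V K)}

lemma not_koszulExact_zero (hI : ∀ f ∈ I, constantCoeff f = 0) :
    ¬ KoszulExact (X : V → MvPolynomial V K) (MvPolynomial V K ⧸ I) 0 := by
  intro h
  obtain ⟨e, -, hes, he⟩ := h (Pi.single ∅ 1) (fun _ => trivial)
    (fun W hW => Pi.single_eq_of_ne (fun h => hW (by simp [h])) _) (by
      ext W
      rw [kdiff_apply]
      refine Finset.sum_eq_zero fun j _ => ?_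
      by_cases hj : j ∈ W
      · rw [contr_of_mem hj, smul_zero]
      · rw [contr_of_notMem hj, Pi.single_eq_of_ne (Finset.insert_ne_empty j W), smul_zero,
          smul_zero])
  have h1 := congrFun he ∅
  rw [kdiff_apply, Pi.single_eq_same] at h1
  have h2 := congrArg (Ideal.Quotient.lift I constantCoeff hI) h1
  rw [map_sum, map_one] at h2
  refine one_ne_zero (α := K) (h2.symm.trans (Finset.sum_eq_zero fun j _ => ?_))
  rw [lift_constantCoeff_smul, constantCoeff_X, zero_mul]

lemma le_depthQ_iff (hI : ∀ f ∈ I, constantCoeff f = 0) {d : ℕ} (hd : d ≤ Fintype.card V) :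
    d ≤ depthQ K I ↔ ∀ s, Fintype.card V < s + d →
      KoszulExact (X : V → MvPolynomial V K) (MvPolynomial V K ⧸ I) s := by
  have hbdd : BddAbove {n | ∃ rs : List (MvPolynomial V K), rs.length = n ∧
      (∀ f ∈ rs, f ∈ Ideal.span (Set.range (X : V → MvPolynomial V K))) ∧
      IsRegular (MvPolynomial V K ⧸ I) rs} := by
    refine ⟨Fintype.card V, ?_⟩
    rintro n ⟨rs, rfl, hm, hrs⟩
    by_contra! hlt
    exact not_koszulExact_zero hI
      (koszulExact_of_isWeaklyRegular X rs hm hrs.toIsWeaklyRegular (by omega))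
  constructor
  · intro hle s hs
    obtain ⟨rs, hl, hm, hrs⟩ := Nat.sSup_mem (s := {n | ∃ rs : List (MvPolynomial V K),
      rs.length = n ∧ (∀ f ∈ rs, f ∈ Ideal.span (Set.range (X : V → MvPolynomial V K))) ∧
      IsRegular (MvPolynomial V K ⧸ I) rs})
      ⟨0, [], rfl, by simp, isRegular_of_isWeaklyRegular hI (by simp) (IsWeaklyRegular.nil _ _)⟩
      hbdd
    refine koszulExact_of_isWeaklyRegular X rs hm hrs.toIsWeaklyRegular ?_
    rw [hl]
    exact hs.trans_le (Nat.add_le_add_left hle s)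
  · intro h
    obtain ⟨rs, hl, hm, hrs⟩ := exists_isWeaklyRegular_of_koszulExact X d hd h
    exact le_csSup hbdd ⟨rs, hl, hm, isRegular_of_isWeaklyRegular hI hm hrs⟩

lemma koszulExact_quotient_iff_familyExact {P : (V →₀ ℕ) → Prop}
    (hP : ∀ f, f ∈ I ↔ ∀ m ∈ f.support, P m) (s : ℕ) :
    KoszulExact (X : V → MvPolynomial V K) (MvPolynomial V K ⧸ I) (s + 1 + 1) ↔
      ∀ e, FamilyExact K (upperKoszul P e) (s + 1) := by
  rw [koszulExact_quotient_iff X I (koszulExact_mvPolynomial s) (koszulExact_mvPolynomial _)]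
  exact ⟨familyExact_of_kExact_ideal hP, kExact_ideal_of_familyExact hP⟩

/-- Depth of the quotient by a symbolic power in terms of upper Koszul complexes. -/
theorem le_depthQ_symbPow_iff {G : SimpleGraph V} {u v : V} (huv : G.Adj u v) {n : ℕ}
    (hn : 1 ≤ n) {d : ℕ} (hd : d < Fintype.card V) :
    d ≤ depthQ K (symbPow K G n) ↔ ∀ s, Fintype.card V ≤ s + d → ∀ e,
      FamilyExact K (upperKoszul (IsCover G n) e) s := by
  rw [le_depthQ_iff (fun f hf => constantCoeff_of_mem_symbPow huv hn hf) hd.le]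
  constructor
  · rintro h (_ | s) hs
    · omega
    · exact (koszulExact_quotient_iff_familyExact mem_symbPow s).1 (h _ (by omega))
  · rintro h (_ | _ | s) hs
    · omega
    · omega
    · exact (koszulExact_quotient_iff_familyExact mem_symbPow s).2 (h _ (by omega))

end Depth

end DS

namespace DS

/-! ### Weighted ordered matchings -/

section Weighted

variable {V : Type*} {G : SimpleGraph V} {n s : ℕ}

/-- The spanning subgraph of the edges `uv` with `p u + p v = n + 1`. -/
def levelGraph (G : SimpleGraph V) (n : ℕ) (p : V → ℕ) : SimpleGraph V where
  Adj u v := G.Adj u v ∧ p u + p v = n + 1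
  symm := ⟨fun u v h => ⟨h.1.symm, by rw [add_comm]; exact h.2⟩⟩
  loopless := ⟨fun u h => h.1.ne rfl⟩

/-- An ordered matching `(a, b)` with weights `α i` on `a i` and `n + 1 - α i` on `b i` such that
adjacent vertices of different matching edges have total weight at least `n + 2`. -/
def IsWeighted (G : SimpleGraph V) (n : ℕ) (a b : Fin s → V) (α : Fin s → ℕ) : Prop :=
  IsOrderedMatching G a b ∧ (∀ i, 1 ≤ α i ∧ α i ≤ n) ∧
    (∀ i j, i ≠ j → G.Adj (a i) (b j) → α j < α i) ∧
    ∀ i j, i ≠ j → G.Adj (b i) (b j) → α i + α j ≤ n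

lemma IsWeighted.mono {a b : Fin s → V} {α : Fin s → ℕ} (h : IsWeighted G n a b α) {m : ℕ}
    (hnm : n ≤ m) : IsWeighted G m a b α :=
  ⟨h.1, fun i => ⟨(h.2.1 i).1, (h.2.1 i).2.trans hnm⟩, h.2.2.1,
    fun i j hij hb => (h.2.2.2 i j hij hb).trans hnm⟩

lemma IsOrderedMatching.isWeighted {a b : Fin s → V} (h : IsOrderedMatching G a b)
    (hn : 2 * s ≤ n) : IsWeighted G n a b (fun i => s - i) := by
  refine ⟨h, fun i => ?_, fun i j hij hab => ?_, fun i j _ _ => ?_⟩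
  · have := i.2
    simp only
    omega
  · have h1 : (i : ℕ) ≤ j := h.2.2 i j hab
    have h2 : (i : ℕ) ≠ j := fun h => hij (Fin.ext h)
    have := j.2
    simp only
    omega
  · simp only
    omega

lemma isWeighted_induce_iff {T : Set V} {a b : Fin s → T} {α : Fin s → ℕ} :
    IsWeighted (G.induce T) n a b α ↔
      IsWeighted G n (fun i => (a i : V)) (fun i => (b i : V)) α := by
  have : Sum.elim (fun i => (a i : V)) (fun i => (b i : V)) = Subtype.val ∘ Sum.elim a b := by
    rw [Sum.comp_elim]
    rfl
  simp only [IsWeighted, IsOrderedMatching, IsMatchingPair, this,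
    Subtype.val_injective.of_comp_iff, SimpleGraph.comap_adj, Function.Embedding.subtype_apply]

lemma isMatchingPair_induce {T : Set V} {a b : Fin s → T} (h : IsMatchingPair (G.induce T) a b) :
    IsMatchingPair G (fun i => (a i : V)) (fun i => (b i : V)) := by
  have : Sum.elim (fun i => (a i : V)) (fun i => (b i : V)) = Subtype.val ∘ Sum.elim a b := by
    rw [Sum.comp_elim]
    rfl
  exact ⟨this ▸ Subtype.val_injective.comp h.1, h.2⟩

/-- An induced matching of the level graph, all of whose adjacent vertices have total weight at
least `n + 1`, gives a weighted ordered matching. -/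
lemma exists_isWeighted {p : V → ℕ} {X : Finset V} {M : Finset (V × V)}
    (hp : ∀ x ∈ X, 1 ≤ p x ∧ ∀ v, G.Adj x v → n + 1 ≤ p x + p v)
    (hM : RMatching (levelGraph G n p) (Sep (levelGraph G n p)) X M) :
    ∃ (a b : Fin M.card → V) (α : Fin M.card → ℕ), IsWeighted G n a b α := by
  have hor : ∀ e : V × V, ∃ f : V × V, (f = e ∨ f = e.swap) ∧ p f.1 ≤ p f.2 := fun e => by
    rcases le_total (p e.1) (p e.2) with h | h
    · exact ⟨e, Or.inl rfl, h⟩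
    · exact ⟨e.swap, Or.inr rfl, h⟩
  choose o ho hop using hor
  let τ : Fin M.card → M := fun i => M.equivFin.symm i
  let f : Fin M.card → V × V := fun i => o (τ i)
  let σ := Tuple.sort fun i => OrderDual.toDual (p (f i).1)
  have hσ : ∀ i j, i ≤ j → p (f (σ j)).1 ≤ p (f (σ i)).1 := fun i j hij =>
    Tuple.monotone_sort (fun i => OrderDual.toDual (p (f i).1)) hij
  have hf : ∀ i, (f i).1 ∈ X ∧ (f i).2 ∈ X ∧ (levelGraph G n p).Adj (f i).1 (f i).2 := fun i => by
    obtain ⟨h1, h2, h12⟩ := hM.1 _ (τ i).2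
    rcases ho (τ i) with h | h
    · simp only [f, h]
      exact ⟨h1, h2, h12⟩
    · simp only [f, h]
      exact ⟨h2, h1, h12.symm⟩
  have hsep : ∀ i j, i ≠ j → ((Sep (levelGraph G n p) (f i).1 (f j).1 ∧
      Sep (levelGraph G n p) (f i).1 (f j).2) ∧ Sep (levelGraph G n p) (f i).2 (f j).1 ∧
      Sep (levelGraph G n p) (f i).2 (f j).2) := fun i j hij => by
    obtain ⟨⟨h1, h2⟩, h3, h4⟩ := hM.2 _ (τ i).2 _ (τ j).2
      fun h => hij (M.equivFin.symm.injective (Subtype.ext h))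
    rcases ho (τ i) with h | h <;> rcases ho (τ j) with h' | h' <;> simp only [f, h, h']
    · exact ⟨⟨h1, h2⟩, h3, h4⟩
    · exact ⟨⟨h2, h1⟩, h4, h3⟩
    · exact ⟨⟨h3, h4⟩, h1, h2⟩
    · exact ⟨⟨h4, h3⟩, h2, h1⟩
  have hlt : ∀ x y, x ∈ X → Sep (levelGraph G n p) x y → G.Adj x y → n + 2 ≤ p x + p y :=
    fun x y hx hs hxy => by
      have h1 := (hp x hx).2 y hxy
      have h2 : p x + p y ≠ n + 1 := fun h => hs.2 ⟨hxy, h⟩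
      omega
  have hsum : ∀ i, p (f i).1 + p (f i).2 = n + 1 := fun i => (hf i).2.2.2
  have hne : ∀ i j, i ≠ j → σ i ≠ σ j := fun i j hij h => hij (σ.injective h)
  have hab : ∀ i j, i ≠ j → G.Adj (f (σ i)).1 (f (σ j)).2 →
      p (f (σ j)).1 < p (f (σ i)).1 := fun i j hij h => by
    have h1 := hlt _ _ (hf _).1 (hsep _ _ (hne i j hij)).1.2 h
    have h2 := hsum (σ j)
    omega
  refine ⟨fun i => (f (σ i)).1, fun i => (f (σ i)).2, fun i => p (f (σ i)).1,
    ⟨⟨?_, fun i => (hf _).2.2.1⟩, fun i j h => ?_, fun i j h => ?_⟩, fun i => ?_, hab,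
    fun i j hij h => ?_⟩
  · refine Function.Injective.sumElim (fun i j hij => ?_) (fun i j hij => ?_) fun i j hij => ?_
    · by_contra hne'
      exact (hsep _ _ (hne i j hne')).1.1.1 hij
    · by_contra hne'
      exact (hsep _ _ (hne i j hne')).2.2.1 hij
    · by_cases hne' : i = j
      · subst hne'
        exact (hf (σ i)).2.2.1.ne hij
      · exact (hsep _ _ (hne i j hne')).1.2.1 hij
  · by_cases hij : i = j
    · subst hij
      exact h.ne rfl
    · have h1 := hlt _ _ (hf _).1 (hsep _ _ (hne i j hij)).1.1 h
      have h2 := hsum (σ i)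
      have h3 := hsum (σ j)
      have h4 : p (f (σ i)).1 ≤ p (f (σ i)).2 := hop _
      have h5 : p (f (σ j)).1 ≤ p (f (σ j)).2 := hop _
      omega
  · by_contra! hlt'
    have h1 := hab i j hlt'.ne' h
    have h2 := hσ j i hlt'.le
    omega
  · have h1 := (hp _ (hf (σ i)).1).1
    have h2 := (hp _ (hf (σ i)).2.1).1
    have h3 := hsum (σ i)
    have h4 : p (f (σ i)).1 ≤ n := by omega
    exact ⟨h1, h4⟩
  · have h1 := hlt _ _ (hf _).2.1 (hsep _ _ (hne i j hij)).2.2 h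
    have h2 := hsum (σ i)
    have h3 := hsum (σ j)
    show p (f (σ i)).1 + p (f (σ j)).1 ≤ n
    omega

end Weighted

section MatchingNumber

variable {V : Type*} [Fintype V] {G : SimpleGraph V} {s : ℕ}

lemma IsMatchingPair.two_mul_le_card {u v : Fin s → V} (h : IsMatchingPair G u v) :
    2 * s ≤ Fintype.card V := by
  have := Fintype.card_le_of_injective _ h.1
  rw [Fintype.card_sum, Fintype.card_fin] at this
  omega

lemma bddAbove_matching (G : SimpleGraph V) :
    BddAbove {s | ∃ u v : Fin s → V, IsMatchingPair G u v} :=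
  ⟨Fintype.card V, by
    rintro s ⟨u, v, h⟩
    have := h.two_mul_le_card
    omega⟩

lemma bddAbove_orderedMatching (G : SimpleGraph V) :
    BddAbove {s | ∃ u v : Fin s → V, IsOrderedMatching G u v} :=
  (bddAbove_matching G).mono (by
    rintro s ⟨u, v, h⟩
    exact ⟨u, v, h.1⟩)

lemma IsMatchingPair.le_nu {u v : Fin s → V} (h : IsMatchingPair G u v) : s ≤ nu G :=
  le_csSup (bddAbove_matching G) ⟨u, v, h⟩

lemma IsOrderedMatching.le_nu0 {u v : Fin s → V} (h : IsOrderedMatching G u v) : s ≤ nu0 G :=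
  le_csSup (bddAbove_orderedMatching G) ⟨u, v, h⟩

lemma exists_isMatchingPair_nu (G : SimpleGraph V) :
    ∃ u v : Fin (nu G) → V, IsMatchingPair G u v :=
  Nat.sSup_mem (s := {s | ∃ u v : Fin s → V, IsMatchingPair G u v})
    ⟨0, Fin.elim0, Fin.elim0, by
      rintro (i | i) <;> exact i.elim0, fun i => i.elim0⟩ (bddAbove_matching G)

lemma exists_isOrderedMatching_nu0 (G : SimpleGraph V) :
    ∃ u v : Fin (nu0 G) → V, IsOrderedMatching G u v :=
  Nat.sSup_mem (s := {s | ∃ u v : Fin s → V, IsOrderedMatching G u v})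
    ⟨0, Fin.elim0, Fin.elim0, ⟨by
      rintro (i | i) <;> exact i.elim0, fun i => i.elim0⟩, fun i => i.elim0, fun i => i.elim0⟩
    (bddAbove_orderedMatching G)

lemma nu0_le_nu (G : SimpleGraph V) : nu0 G ≤ nu G := by
  obtain ⟨u, v, h⟩ := exists_isOrderedMatching_nu0 G
  exact h.1.le_nu

lemma nu_induce_le (G : SimpleGraph V) (T : Set V) [Fintype T] : nu (G.induce T) ≤ nu G := by
  obtain ⟨u, v, h⟩ := exists_isMatchingPair_nu (G.induce T)
  exact (isMatchingPair_induce h).le_nu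

lemma RMatching.card_le_nu {X : Finset V} {M : Finset (V × V)} (h : RMatching G (· ≠ ·) X M) :
    M.card ≤ nu G := by
  let τ : Fin M.card → M := fun i => M.equivFin.symm i
  have hsep : ∀ i j, i ≠ j → _ := fun i j hij => h.2 _ (τ i).2 _ (τ j).2
    fun h => hij (M.equivFin.symm.injective (Subtype.ext h))
  have : IsMatchingPair G (fun i => (τ i).1.1) (fun i => (τ i).1.2) := by
    refine ⟨Function.Injective.sumElim (fun i j hij => ?_) (fun i j hij => ?_) fun i j hij => ?_,
      fun i => (h.1 _ (τ i).2).2.2⟩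
    · by_contra hne
      exact (hsep i j hne).1.1 hij
    · by_contra hne
      exact (hsep i j hne).2.2 hij
    · by_cases hne : i = j
      · subst hne
        exact (h.1 _ (τ i).2).2.2.ne hij
      · exact (hsep i j hne).1.2 hij
  exact this.le_nu

lemma one_le_nu {u v : V} (huv : G.Adj u v) : 1 ≤ nu G := by
  refine IsMatchingPair.le_nu (u := fun _ : Fin 1 => u) (v := fun _ => v)
    ⟨Function.Injective.sumElim (fun i j _ => Subsingleton.elim i j)
      (fun i j _ => Subsingleton.elim i j) fun _ _ => huv.ne, fun _ => huv⟩

end MatchingNumber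

section DepthSymbolic

variable {V : Type*} [LinearOrder V] {G : SimpleGraph V} {n s : ℕ}

lemma isCover_sub_ind {e : V →₀ ℕ} {W : Finset V} :
    IsCover G n (e - ind W) ↔ ∀ u v, G.Adj u v →
      n ≤ (e u - if u ∈ W then 1 else 0) + (e v - if v ∈ W then 1 else 0) := by
  simp [IsCover, ind_apply]

lemma upperKoszul_isCover_subset (e : V →₀ ℕ) (U W : Finset V) (hUW : U ⊆ W)
    (h : upperKoszul (IsCover G n) e W) : upperKoszul (IsCover G n) e U := by
  have hle : ind U ≤ ind W := fun j => by
    rw [ind_apply, ind_apply]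
    split_ifs with h1 h2
    · rfl
    · exact absurd (hUW h1) h2
    · omega
    · rfl
  refine ⟨hle.trans h.1, fun u v huv => (h.2 u v huv).trans ?_⟩
  exact add_le_add (tsub_le_tsub_left hle e u) (tsub_le_tsub_left hle e v)

/-- On a set of vertices of positive weight whose edges are heavy, the upper Koszul complex is the
complex of independent sets of the level graph. -/
lemma upperKoszul_iff_indepFamily {e : V →₀ ℕ} {X : Finset V} (he : IsCover G n e)
    (hX : ∀ x ∈ X, 1 ≤ e x ∧ ∀ v, G.Adj x v → n + 1 ≤ e x + e v) {W : Finset V} :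
    W ⊆ X ∧ upperKoszul (IsCover G n) e W ↔ indepFamily (levelGraph G n e) X W := by
  constructor
  · rintro ⟨hWX, -, h⟩
    refine ⟨hWX, fun u hu v hv huv => ?_⟩
    have h1 := isCover_sub_ind.1 h u v huv.1
    rw [if_pos hu, if_pos hv] at h1
    have h2 := huv.2
    have h3 := (hX u (hWX hu)).1
    have h4 := (hX v (hWX hv)).1
    omega
  · rintro ⟨hWX, h⟩
    refine ⟨hWX, fun j => ?_, isCover_sub_ind.2 fun u v huv => ?_⟩
    · rw [ind_apply]
      split_ifs with hj
      · exact (hX j (hWX hj)).1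
      · exact Nat.zero_le _
    · have h0 := he u v huv
      by_cases hu : u ∈ W <;> by_cases hv : v ∈ W <;> simp only [hu, hv, if_true, if_false]
      · have h1 := (hX u (hWX hu)).2 v huv
        have h2 : e u + e v ≠ n + 1 := fun h' => h u hu v hv ⟨huv, h'⟩
        have h3 := (hX u (hWX hu)).1
        have h4 := (hX v (hWX hv)).1
        omega
      · have h1 := (hX u (hWX hu)).2 v huv
        have h3 := (hX u (hWX hu)).1
        omega
      · have h1 := (hX v (hWX hv)).2 u huv.symm
        have h3 := (hX v (hWX hv)).1
        omega
      · simpa using h0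

variable [Fintype V] {K : Type*} [Field K]

lemma exists_not_familyExact_indepFamily {e : V →₀ ℕ}
    (h : ¬ FamilyExact K (upperKoszul (IsCover G n) e) s) : ∃ X : Finset V,
      (∀ x ∈ X, 1 ≤ e x ∧ ∀ v, G.Adj x v → n + 1 ≤ e x + e v) ∧
      ¬ FamilyExact K (indepFamily (levelGraph G n e) X) s := by
  classical
  have he : IsCover G n e := by
    by_contra hne
    refine h (FamilyExact.of_not fun W _ hW => hne fun u v huv => (hW.2 u v huv).trans ?_)
    exact add_le_add (Nat.sub_le _ _) (Nat.sub_le _ _)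
  let X : Finset V := {x | 1 ≤ e x ∧ ∀ v, G.Adj x v → n + 1 ≤ e x + e v}
  have hX : ∀ x ∈ X, 1 ≤ e x ∧ ∀ v, G.Adj x v → n + 1 ≤ e x + e v := fun x hx => by
    simpa [X] using hx
  refine ⟨X, hX, fun hex => h (hex.congr fun W => ?_)⟩
  rw [← upperKoszul_iff_indepFamily he hX, and_iff_right_iff_imp]
  intro hW j hj
  have h1 : 1 ≤ e j := by
    have := hW.1 j
    rwa [ind_apply, if_pos hj] at this
  refine Finset.mem_filter.2 ⟨Finset.mem_univ j, h1, fun v hv => ?_⟩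
  have := isCover_sub_ind.1 hW.2 j v hv
  rw [if_pos hj] at this
  omega

/-- Homology of a full restriction of an upper Koszul complex comes from homology of some upper
Koszul complex. -/
lemma exists_not_familyExact_upperKoszul : ∀ (N : ℕ) (g : V →₀ ℕ) (Y : Finset V),
    ∑ v, g v + (Finset.univ \ Y).card = N →
    ¬ FamilyExact K (fun W => W ⊆ Y ∧ upperKoszul (IsCover G n) g W) s →
    ∃ e, ¬ FamilyExact K (upperKoszul (IsCover G n) e) s := by
  intro N
  induction N using Nat.strong_induction_on with
  | _ N ih =>
  rintro g Y rfl h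
  by_cases hY : ∀ j, j ∉ Y → g j = 0
  · refine ⟨g, fun hex => h (hex.congr fun W => ?_)⟩
    refine (and_iff_right_of_imp fun hW j hj => ?_).symm
    by_contra hjY
    have := hW.1 j
    rw [ind_apply, if_pos hj, hY j hjY] at this
    omega
  push Not at hY
  obtain ⟨j, hj, hgj⟩ := hY
  have hsingle : Finsupp.single j 1 ≤ g := Finsupp.single_le_iff.2 (Nat.one_le_iff_ne_zero.2 hgj)
  let F : Finset V → Prop := fun W => W ⊆ insert j Y ∧ upperKoszul (IsCover G n) g W
  have hF : ∀ U W, U ⊆ W → F W → F U := fun U W hUW hW =>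
    ⟨hUW.trans hW.1, upperKoszul_isCover_subset g U W hUW hW.2⟩
  by_cases hFex : FamilyExact K F s
  · by_cases hlk : FamilyExact K (lk F j) s
    · refine absurd ((FamilyExact.del_of_lk hF j hFex hlk).congr fun W => ?_) h
      constructor
      · rintro ⟨hjW, hW, h'⟩
        exact ⟨(Finset.subset_insert_iff_of_notMem hjW).1 hW, h'⟩
      · rintro ⟨hW, h'⟩
        exact ⟨fun hjW => hj (hW hjW), hW.trans (Finset.subset_insert j Y), h'⟩
    · refine ih _ ?_ (g - Finsupp.single j 1) Y rfl fun hex => hlk (hex.congr fun W => ?_)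
      · have h1 : ∑ v, (g - Finsupp.single j 1 : V →₀ ℕ) v < ∑ v, g v := by
          refine Finset.sum_lt_sum (fun i _ => Nat.sub_le _ _) ⟨j, Finset.mem_univ j, ?_⟩
          simp only [Finsupp.coe_tsub, Pi.sub_apply, Finsupp.single_eq_same]
          omega
        omega
      · have key : ∀ W : Finset V, j ∉ W → (upperKoszul (IsCover G n) (g - Finsupp.single j 1) W ↔
            upperKoszul (IsCover G n) g (insert j W)) := fun W hjW => by
          rw [upperKoszul, upperKoszul, ind_insert hjW, le_tsub_iff_right hsingle,
            tsub_tsub, add_comm (Finsupp.single j 1)]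
        constructor
        · rintro ⟨hW, h'⟩
          have hjW : j ∉ W := fun hjW => hj (hW hjW)
          exact ⟨hjW, Finset.insert_subset_insert j hW, (key W hjW).1 h'⟩
        · rintro ⟨hjW, hW, h'⟩
          refine ⟨fun w hw => ?_, (key W hjW).2 h'⟩
          exact (Finset.mem_insert.1 (hW (Finset.mem_insert_of_mem hw))).resolve_left
            fun h => hjW (h ▸ hw)
  · refine ih _ ?_ g (insert j Y) rfl hFex
    refine Nat.add_lt_add_left (Finset.card_lt_card ⟨?_, fun hsub => ?_⟩) _
    · exact Finset.sdiff_subset_sdiff le_rfl (Finset.subset_insert j Y)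
    · have := hsub (Finset.mem_sdiff.2 ⟨Finset.mem_univ j, hj⟩)
      simp at this

lemma IsWeighted.exists_not_familyExact {a b : Fin s → V} {α : Fin s → ℕ}
    (h : IsWeighted G n a b α) : ∃ e, ¬ FamilyExact K (upperKoszul (IsCover G n) e) s := by
  obtain ⟨⟨⟨hinj, hadj⟩, haa, -⟩, hα, hab, hbb⟩ := h
  let q : V → ℕ :=
    Function.extend (Sum.elim a b) (Sum.elim α fun i => n + 1 - α i) fun _ => n + 1
  let g : V →₀ ℕ := Finsupp.equivFunOnFinite.symm q
  have hga : ∀ i, g (a i) = α i := fun i =>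
    hinj.extend_apply (Sum.elim α fun i => n + 1 - α i) (fun _ => n + 1) (Sum.inl i)
  have hgb : ∀ i, g (b i) = n + 1 - α i := fun i =>
    hinj.extend_apply (Sum.elim α fun i => n + 1 - α i) (fun _ => n + 1) (Sum.inr i)
  let X : Finset V := Finset.univ.image (Sum.elim a b)
  have hX : ∀ x, x ∈ X ↔ (∃ i, x = a i) ∨ ∃ i, x = b i := fun x => by
    simp [X, eq_comm]
  have hgX : ∀ x, x ∉ X → g x = n + 1 := fun x hx =>
    Function.extend_apply' (Sum.elim α fun i => n + 1 - α i) (fun _ => n + 1) x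
      fun ⟨i, hi⟩ => hx (hi ▸ Finset.mem_image_of_mem _ (Finset.mem_univ i))
  have haX : ∀ i, a i ∈ X := fun i => (hX _).2 (Or.inl ⟨i, rfl⟩)
  have hbX : ∀ i, b i ∈ X := fun i => (hX _).2 (Or.inr ⟨i, rfl⟩)
  have hne : ∀ i j, a i ≠ b j := fun i j hij => by
    simpa using hinj (a₁ := Sum.inl i) (a₂ := Sum.inr j) hij
  have hheavy : ∀ i j, i ≠ j → (G.Adj (a i) (b j) → n + 2 ≤ g (a i) + g (b j)) ∧
      (G.Adj (b i) (b j) → n + 2 ≤ g (b i) + g (b j)) := fun i j hij => by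
    rw [hga, hgb, hgb]
    have h1 := hα i
    have h2 := hα j
    refine ⟨fun h => ?_, fun h => ?_⟩
    · have := hab i j hij h
      omega
    · have := hbb i j hij h
      omega
  have hsum : ∀ i, g (a i) + g (b i) = n + 1 := fun i => by
    rw [hga, hgb]
    have := hα i
    omega
  have hpos : ∀ x ∈ X, 1 ≤ g x := fun x hx => by
    rcases (hX x).1 hx with ⟨i, rfl⟩ | ⟨i, rfl⟩
    · rw [hga]
      exact (hα i).1
    · rw [hgb]
      have := hα i
      omega
  have hlevel : ∀ x ∈ X, 1 ≤ g x ∧ ∀ v, G.Adj x v → n + 1 ≤ g x + g v := fun x hx => by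
    refine ⟨hpos x hx, fun v hxv => ?_⟩
    by_cases hv : v ∈ X
    · rcases (hX x).1 hx with ⟨i, rfl⟩ | ⟨i, rfl⟩ <;> rcases (hX v).1 hv with ⟨j, rfl⟩ | ⟨j, rfl⟩
      · exact absurd hxv (haa i j)
      · by_cases hij : i = j
        · rw [hij, hsum]
        · have := (hheavy i j hij).1 hxv
          omega
      · by_cases hij : j = i
        · rw [hij, add_comm (g (b i)), hsum]
        · have := (hheavy j i hij).1 hxv.symm
          omega
      · by_cases hij : i = j
        · exact absurd (congrArg b hij) hxv.ne
        · have := (hheavy i j hij).2 hxv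
          omega
    · rw [hgX v hv]
      omega
  have hcover : IsCover G n g := fun u v huv => by
    by_cases hu : u ∈ X
    · have := (hlevel u hu).2 v huv
      omega
    · rw [hgX u hu]
      omega
  let M : Finset (V × V) := Finset.univ.image fun i => (a i, b i)
  have hMc : M.card = s := by
    rw [Finset.card_image_of_injective, Finset.card_univ, Fintype.card_fin]
    intro i j hij
    simpa using hinj (a₁ := Sum.inl i) (a₂ := Sum.inl j) (congrArg Prod.fst hij)
  have hM : RMatching (levelGraph G n g) (Sep (levelGraph G n g)) X M := by
    constructor
    · intro e he
      obtain ⟨i, -, rfl⟩ := Finset.mem_image.1 he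
      exact ⟨haX i, hbX i, hadj i, hsum i⟩
    · intro e he f hf hef
      obtain ⟨i, -, rfl⟩ := Finset.mem_image.1 he
      obtain ⟨j, -, rfl⟩ := Finset.mem_image.1 hf
      have hij : i ≠ j := fun h => hef (by rw [h])
      refine ⟨⟨⟨fun h => ?_, fun h => haa i j h.1⟩, ⟨hne i j, fun h => ?_⟩⟩,
        ⟨(hne j i).symm, fun h => ?_⟩, ⟨fun h => ?_, fun h => ?_⟩⟩
      · exact hij (by simpa using hinj (a₁ := Sum.inl i) (a₂ := Sum.inl j) h)
      · have h1 := (hheavy i j hij).1 h.1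
        have h2 : g (a i) + g (b j) = n + 1 := h.2
        omega
      · have h1 := (hheavy j i hij.symm).1 h.1.symm
        have h2 : g (b i) + g (a j) = n + 1 := h.2
        omega
      · exact hij (by simpa using hinj (a₁ := Sum.inr i) (a₂ := Sum.inr j) h)
      · have h1 := (hheavy i j hij).2 h.1
        have h2 : g (b i) + g (b j) = n + 1 := h.2
        omega
  have hMX : ∀ x ∈ X, ∃ e ∈ M, x = e.1 ∨ x = e.2 := fun x hx => by
    rcases (hX x).1 hx with ⟨i, rfl⟩ | ⟨i, rfl⟩
    · exact ⟨_, Finset.mem_image_of_mem _ (Finset.mem_univ i), Or.inl rfl⟩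
    · exact ⟨_, Finset.mem_image_of_mem _ (Finset.mem_univ i), Or.inr rfl⟩
  have hnot := not_familyExact_of_inducedMatching (K := K) M X hM hMX
  rw [hMc] at hnot
  exact exists_not_familyExact_upperKoszul _ g X rfl fun hex =>
    hnot (hex.congr fun W => upperKoszul_iff_indepFamily hcover hlevel)

/-- The depth of the quotients by symbolic powers of the cover ideal of a graph with
`ν(G) = ν₀(G)` and without cycles of length five is minimal exactly when there is a weighted
ordered matching. -/
theorem depthQ_symbPow_eq_iff {u v : V} (huv : G.Adj u v) (hnu : nu G = nu0 G)
    (hC : ∀ x y a b w, G.Adj x y → G.Adj y a → G.Adj a b → G.Adj b w → G.Adj w x →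
      x ≠ a → x ≠ b → y ≠ b → y ≠ w → a ≠ w → False) (hn : 1 ≤ n) :
    depthQ K (symbPow K G n) = Fintype.card V - nu0 G - 1 ↔
      ∃ (a b : Fin (nu0 G) → V) (α : Fin (nu0 G) → ℕ), IsWeighted G n a b α := by
  have h1 : 1 ≤ nu0 G := hnu ▸ one_le_nu huv
  have h2 : 2 * nu0 G ≤ Fintype.card V := by
    obtain ⟨u, v, h⟩ := exists_isOrderedMatching_nu0 G
    exact h.1.two_mul_le_card
  have hlevel : ∀ {p : V → ℕ} {X : Finset V} {M : Finset (V × V)},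
      RMatching (levelGraph G n p) (· ≠ ·) X M → M.card ≤ nu0 G := fun {p X M} h =>
    hnu ▸ RMatching.card_le_nu (G := G) (X := X)
      ⟨fun e he => ⟨(h.1 e he).1, (h.1 e he).2.1, (h.1 e he).2.2.1⟩, h.2⟩
  have hle : ∀ {s : ℕ} {e : V →₀ ℕ}, ¬ FamilyExact K (upperKoszul (IsCover G n) e) s →
      s ≤ nu0 G := fun {s e} h => by
    obtain ⟨X, -, hX⟩ := exists_not_familyExact_indepFamily h
    obtain ⟨M, hM, rfl⟩ := exists_matching_of_not_familyExact _ _ _ rfl hX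
    exact hlevel hM
  have hlow : Fintype.card V - nu0 G - 1 ≤ depthQ K (symbPow K G n) := by
    rw [le_depthQ_symbPow_iff huv hn (by omega)]
    intro s hs e
    by_contra h
    have := hle h
    omega
  have hup : depthQ K (symbPow K G n) = Fintype.card V - nu0 G - 1 ↔
      ¬ Fintype.card V - nu0 G ≤ depthQ K (symbPow K G n) := by omega
  rw [hup, le_depthQ_symbPow_iff huv hn (by omega)]
  constructor
  · intro h
    push Not at h
    obtain ⟨s, hs, e, he⟩ := h
    obtain rfl : s = nu0 G := le_antisymm (hle he) (by omega)
    obtain ⟨X, hX, hXe⟩ := exists_not_familyExact_indepFamily he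
    obtain ⟨M, hM, hMc⟩ := exists_inducedMatching_of_not_familyExact (Γ := levelGraph G n e)
      (fun x y a b w h1 h2 h3 h4 h5 => hC x y a b w h1.1 h2.1 h3.1 h4.1 h5.1) _ _ _ rfl
      (fun M hM hMc => by
        have := hlevel hM
        omega) hXe
    rw [← hMc]
    exact exists_isWeighted hX hM
  · rintro ⟨a, b, α, hw⟩ h
    obtain ⟨e, he⟩ := hw.exists_not_familyExact (K := K)
    exact he (h _ (by omega) e)

/-- The stability index is the least exponent admitting a weighted ordered matching. -/
theorem sdst_eq_sInf {u v : V} (huv : G.Adj u v) (hnu : nu G = nu0 G)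
    (hC : ∀ x y a b w, G.Adj x y → G.Adj y a → G.Adj a b → G.Adj b w → G.Adj w x →
      x ≠ a → x ≠ b → y ≠ b → y ≠ w → a ≠ w → False) :
    sdst K G = sInf {n | 1 ≤ n ∧
      ∃ (a b : Fin (nu0 G) → V) (α : Fin (nu0 G) → ℕ), IsWeighted G n a b α} := by
  rw [sdst]
  congr 1
  ext n
  constructor
  · rintro ⟨hn, h⟩
    exact ⟨hn, (depthQ_symbPow_eq_iff huv hnu hC hn).1 (h n le_rfl)⟩
  · rintro ⟨hn, a, b, α, h⟩
    exact ⟨hn, fun m hm => (depthQ_symbPow_eq_iff huv hnu hC (hn.trans hm)).2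
      ⟨a, b, α, h.mono hm⟩⟩

end DepthSymbolic

end DS

namespace DS

lemma false_of_five_cycle {V : Type*} {G : SimpleGraph V}
    (hC5 : ∀ (x : V) (c : G.Walk x x), c.IsCycle → c.length ≠ 5) {x y a b w : V}
    (hxy : G.Adj x y) (hya : G.Adj y a) (hab : G.Adj a b) (hbw : G.Adj b w) (hwx : G.Adj w x)
    (hxa : x ≠ a) (hxb : x ≠ b) (hyb : y ≠ b) (hyw : y ≠ w) (haw : a ≠ w) : False := by
  refine hC5 x (.cons hxy (.cons hya (.cons hab (.cons hbw (.cons hwx .nil))))) ?_ rfl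
  rw [SimpleGraph.Walk.cons_isCycle_iff, SimpleGraph.Walk.isPath_def]
  have h1 := hxy.ne
  have h2 := hya.ne
  have h3 := hab.ne
  have h4 := hbw.ne
  have h5 := hwx.ne
  simp [h1.symm, h2, h3, h4, h5, hxa.symm, hxb.symm, hyb, hyw, haw, h1, hxa, hxb, h5.symm]

end DS

/-- If `ν(G) = ν₀(G)` and `G` contains no cycle of length 5, then there is an induced
subgraph `H` of `G` with `ν₀(H) = ν₀(G)` such that `H` has a perfect ordered matching
and `sdst(J(G)) = sdst(J(H))`. -/
theorem stmt_13 (K : Type*) [Field K] {r : ℕ} (G : SimpleGraph (Fin r))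
    (hE : G.edgeSet.Nonempty)
    (hnu : DS.nu G = DS.nu0 G)
    (hC5 : ∀ (x : Fin r) (c : G.Walk x x), c.IsCycle → c.length ≠ 5) :
    ∃ S : Finset (Fin r),
      DS.nu0 (G.induce (S : Set (Fin r))) = DS.nu0 G ∧
      (∃ (t : ℕ) (u v : Fin t → (S : Set (Fin r))),
        DS.IsOrderedMatching (G.induce (S : Set (Fin r))) u v ∧
        Function.Surjective (Sum.elim u v)) ∧
      DS.sdst K G = DS.sdst K (G.induce (S : Set (Fin r))) := by
  obtain ⟨x₀, y₀, hxy⟩ : ∃ x y, G.Adj x y := by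
    obtain ⟨e, he⟩ := hE
    induction e with
    | h x y => exact ⟨x, y, he⟩
  have hC : ∀ x y a b w, G.Adj x y → G.Adj y a → G.Adj a b → G.Adj b w → G.Adj w x →
      x ≠ a → x ≠ b → y ≠ b → y ≠ w → a ≠ w → False :=
    fun x y a b w h1 h2 h3 h4 h5 n1 n2 n3 n4 n5 =>
      DS.false_of_five_cycle hC5 h1 h2 h3 h4 h5 n1 n2 n3 n4 n5
  have hpos : 1 ≤ DS.nu0 G := hnu ▸ DS.one_le_nu hxy
  let W : Set ℕ := {n | 1 ≤ n ∧ ∃ (a b : Fin (DS.nu0 G) → Fin r) (α : Fin (DS.nu0 G) → ℕ),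
    DS.IsWeighted G n a b α}
  have hsd : DS.sdst K G = sInf W := DS.sdst_eq_sInf hxy hnu hC
  have hW : W.Nonempty := by
    obtain ⟨a, b, h⟩ := DS.exists_isOrderedMatching_nu0 G
    exact ⟨2 * DS.nu0 G, by omega, a, b, _, h.isWeighted le_rfl⟩
  obtain ⟨hn, a, b, α, hw⟩ := Nat.sInf_mem hW
  let S : Finset (Fin r) := Finset.univ.image (Sum.elim a b)
  have hS : ∀ z, Sum.elim a b z ∈ (S : Set (Fin r)) := fun z =>
    Finset.mem_coe.2 (Finset.mem_image_of_mem _ (Finset.mem_univ z))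
  let a' : Fin (DS.nu0 G) → (S : Set (Fin r)) := fun i => ⟨a i, hS (Sum.inl i)⟩
  let b' : Fin (DS.nu0 G) → (S : Set (Fin r)) := fun i => ⟨b i, hS (Sum.inr i)⟩
  have hw' : DS.IsWeighted (G.induce (S : Set (Fin r))) (sInf W) a' b' α :=
    DS.isWeighted_induce_iff.2 hw
  have h1 : DS.nu0 G ≤ DS.nu0 (G.induce (S : Set (Fin r))) := hw'.1.le_nu0
  have h2 := DS.nu0_le_nu (G.induce (S : Set (Fin r)))
  have h3 := DS.nu_induce_le G (S : Set (Fin r))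
  have hnu0 : DS.nu0 (G.induce (S : Set (Fin r))) = DS.nu0 G := by omega
  refine ⟨S, hnu0, ⟨DS.nu0 G, a', b', hw'.1, ?_⟩, ?_⟩
  · rintro ⟨x, hx⟩
    obtain ⟨i | i, -, hi⟩ := Finset.mem_image.1 (Finset.mem_coe.1 hx)
    · exact ⟨Sum.inl i, Subtype.ext hi⟩
    · exact ⟨Sum.inr i, Subtype.ext hi⟩
  · rw [DS.sdst_eq_sInf (K := K) (G := G.induce (S : Set (Fin r)))
      (hw'.1.1.2 ⟨0, hpos⟩) (by omega)
      (fun x y a b w h1 h2 h3 h4 h5 n1 n2 n3 n4 n5 => hC x y a b w h1 h2 h3 h4 h5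
        (Subtype.coe_ne_coe.2 n1) (Subtype.coe_ne_coe.2 n2) (Subtype.coe_ne_coe.2 n3)
        (Subtype.coe_ne_coe.2 n4) (Subtype.coe_ne_coe.2 n5)), hnu0, hsd]
    have hmem : sInf W ∈ {n | 1 ≤ n ∧ ∃ (a b : Fin (DS.nu0 G) → (S : Set (Fin r)))
        (α : Fin (DS.nu0 G) → ℕ), DS.IsWeighted (G.induce (S : Set (Fin r))) n a b α} :=
      ⟨hn, a', b', α, hw'⟩
    refine le_antisymm ?_ (Nat.sInf_le hmem)
    obtain ⟨hm, c, d, β, hβ⟩ := Nat.sInf_mem ⟨_, hmem⟩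
    exact Nat.sInf_le ⟨hm, _, _, β, DS.isWeighted_induce_iff.1 hβ⟩
end

section
/- Let P_r be the path graph with r ≥ 2 vertices 1,…,r and edges {i,i+1} for 1 ≤ i ≤ r−1, and let J(P_r) be its cover ideal in R = K[x_1,…,x_r]. Then dst(J(P_r)) = r/2 if r is even, and dst(J(P_r)) = ⌈(r−1)/4⌉ if r is odd (and r ≥ 3). -/
open SimpleGraph

section Auxiliary

open RingTheory.Sequence CategoryTheory Abelian Pointwise

universe u

section Socle

variable {R : Type u} [CommRing R]

lemma Ideal.Quotient.mk_mem_smul_top_iff (I J : Ideal R) (p : R) :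
    (Ideal.Quotient.mk I p) ∈ (J • ⊤ : Submodule R (R ⧸ I)) ↔ p ∈ I ⊔ J := by
  have h : (J • ⊤ : Submodule R (R ⧸ I)) = Submodule.map (Submodule.mkQ I) J := by
    have := Submodule.map_smul'' J (⊤ : Submodule R R) (Submodule.mkQ I)
    rw [Submodule.map_top, Submodule.range_mkQ] at this
    rw [← this]; simp
  rw [h, sup_comm]
  have := Submodule.comap_map_eq (Submodule.mkQ I) J
  rw [Submodule.ker_mkQ] at this
  rw [← this]; rfl

lemma isSMulRegular_quotient_smul_top_iff (I J : Ideal R) (x : R) :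
    IsSMulRegular ((R ⧸ I) ⧸ (J • ⊤ : Submodule R (R ⧸ I))) x ↔
      ∀ p, x * p ∈ I ⊔ J → p ∈ I ⊔ J := by
  rw [isSMulRegular_quotient_iff_mem_of_smul_mem]
  constructor
  · intro h p hp
    rw [← Ideal.Quotient.mk_mem_smul_top_iff] at hp ⊢
    exact h _ hp
  · intro h y
    obtain ⟨p, rfl⟩ := Ideal.Quotient.mk_surjective y
    intro hp
    rw [Ideal.Quotient.mk_mem_smul_top_iff]
    apply h
    rw [← Ideal.Quotient.mk_mem_smul_top_iff]
    exact hp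

lemma subsingleton_linearMap_of_subsingleton_ext (N : ModuleCat.{u} R) (M : ModuleCat.{u} R)
    (rs : List R) (reg : IsWeaklyRegular M rs)
    (h : ∀ i < rs.length + 1, Subsingleton (Ext N M i)) :
    Subsingleton (N →ₗ[R] M ⧸ (Ideal.ofList rs • ⊤ : Submodule R M)) := by
  induction rs generalizing M with
  | nil =>
    have : Subsingleton (N →ₗ[R] M) :=
      (Ext.addEquiv₀.trans ModuleCat.homAddEquiv).subsingleton_congr.mp (h 0 (by simp))
    have e : (M ⧸ (Ideal.ofList ([] : List R) • ⊤ : Submodule R M)) ≃ₗ[R] M :=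
      Submodule.quotEquivOfEqBot _ (by simp)
    refine ⟨fun f g => ?_⟩
    ext x
    apply e.injective
    exact LinearMap.congr_fun (Subsingleton.elim (e.toLinearMap ∘ₗ f) (e.toLinearMap ∘ₗ g)) x
  | cons a rs ih =>
    rw [isWeaklyRegular_cons_iff] at reg
    have := ih (ModuleCat.of R (QuotSMulTop a M)) reg.2 fun i hi => by
      have zero1 := AddCommGrpCat.isZero_of_iff_subsingleton.mpr
        (h i (by simp only [List.length_cons]; omega))
      have zero2 := AddCommGrpCat.isZero_of_iff_subsingleton.mpr
        (h (i + 1) (by simp only [List.length_cons]; omega))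
      exact AddCommGrpCat.subsingleton_of_isZero <| ShortComplex.Exact.isZero_of_both_zeros
        ((Ext.covariant_sequence_exact₃' N reg.1.smulShortComplex_shortExact) i (i + 1) rfl)
        (zero1.eq_zero_of_src _) (zero2.eq_zero_of_tgt _)
    have e := Submodule.quotOfListConsSMulTopEquivQuotSMulTopInner M a rs
    refine ⟨fun f g => ?_⟩
    ext x
    apply e.injective
    exact LinearMap.congr_fun (Subsingleton.elim (e.toLinearMap ∘ₗ f) (e.toLinearMap ∘ₗ g)) x

lemma Ideal.smul_top_quotient_lt_top {I m : Ideal R} (hm : m ≠ ⊤) (hI : I ≤ m) :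
    (m • ⊤ : Submodule R (R ⧸ I)) < ⊤ := by
  rw [lt_top_iff_ne_top]
  intro h
  have : Ideal.Quotient.mk I 1 ∈ (m • ⊤ : Submodule R (R ⧸ I)) := by rw [h]; trivial
  rw [Ideal.Quotient.mk_mem_smul_top_iff, sup_eq_right.mpr hI] at this
  exact hm ((Ideal.eq_top_iff_one _).mpr this)

lemma length_le_of_socle [IsNoetherianRing R] {I m : Ideal R} (hm : m ≠ ⊤) (hI : I ≤ m)
    {θ : List R} (hθ : IsWeaklyRegular (R ⧸ I) θ) {p : R} (hp : p ∉ I ⊔ Ideal.ofList θ)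
    (hmp : ∀ x ∈ m, x * p ∈ I ⊔ Ideal.ofList θ) {rs : List R} (hrs : ∀ f ∈ rs, f ∈ m)
    (reg : IsRegular (R ⧸ I) rs) : rs.length ≤ θ.length := by
  by_contra! hlt
  have hsupp : Module.support R (R ⧸ m) ⊆ PrimeSpectrum.zeroLocus m := by
    rw [Module.support_eq_zeroLocus, Ideal.annihilator_quotient]
  have hext := ModuleCat.subsingleton_ext_of_exists_isRegular m (ModuleCat.of R (R ⧸ m)) hsupp
    (ModuleCat.of R (R ⧸ I)) (Ideal.smul_top_quotient_lt_top hm hI) rs hrs reg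
  have hsub := subsingleton_linearMap_of_subsingleton_ext (ModuleCat.of R (R ⧸ m))
    (ModuleCat.of R (R ⧸ I)) θ hθ fun i hi => hext i (by omega)
  obtain ⟨x, hx, hreg⟩ := IsSMulRegular.subsingleton_linearMap_iff.mp hsub
  rw [show Module.annihilator R (ModuleCat.of R (R ⧸ m)) = m from Ideal.annihilator_quotient] at hx
  exact hp ((isSMulRegular_quotient_smul_top_iff I _ x).mp hreg p (hmp x hx))

lemma exists_isRegular_of_no_socle [IsNoetherianRing R] {I m : Ideal R} (hm : m ≠ ⊤) (hI : I ≤ m)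
    {θ : List R} (hθ : IsWeaklyRegular (R ⧸ I) θ) (hθm : ∀ f ∈ θ, f ∈ m)
    (h : ∀ p, (∀ x ∈ m, x * p ∈ I ⊔ Ideal.ofList θ) → p ∈ I ⊔ Ideal.ofList θ) :
    ∃ rs : List R, rs.length = θ.length + 1 ∧ (∀ f ∈ rs, f ∈ m) ∧ IsRegular (R ⧸ I) rs := by
  have hsub : Subsingleton
      ((R ⧸ m) →ₗ[R] (R ⧸ I) ⧸ (Ideal.ofList θ • ⊤ : Submodule R (R ⧸ I))) := by
    refine subsingleton_of_forall_eq 0 fun f => ?_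
    suffices f (Ideal.Quotient.mk m 1) = 0 by
      ext
      exact this
    obtain ⟨y, hy⟩ := Submodule.Quotient.mk_surjective _ (f (Ideal.Quotient.mk m 1))
    obtain ⟨p, rfl⟩ := Ideal.Quotient.mk_surjective y
    rw [← hy, Submodule.Quotient.mk_eq_zero, Ideal.Quotient.mk_mem_smul_top_iff]
    refine h p fun x hx => ?_
    rw [← Ideal.Quotient.mk_mem_smul_top_iff, ← Submodule.Quotient.mk_eq_zero]
    have hx1 : x • (Ideal.Quotient.mk m 1) = 0 := by
      rw [← Ideal.Quotient.mk_eq_mk, ← Submodule.Quotient.mk_smul, Submodule.Quotient.mk_eq_zero]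
      simpa using hx
    have : x • f (Ideal.Quotient.mk m 1) = 0 := by rw [← map_smul, hx1, map_zero]
    rw [← hy] at this
    exact this
  obtain ⟨x, hx, hreg⟩ := IsSMulRegular.subsingleton_linearMap_iff.mp hsub
  rw [Ideal.annihilator_quotient] at hx
  have hmem : ∀ f ∈ θ ++ [x], f ∈ m := by
    simp only [List.mem_append, List.mem_singleton]
    rintro f (hf | rfl)
    exacts [hθm f hf, hx]
  refine ⟨θ ++ [x], by simp, hmem, ?_, ?_⟩
  · rw [isWeaklyRegular_append_iff, isWeaklyRegular_singleton_iff]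
    exact ⟨hθ, hreg⟩
  · refine (lt_of_le_of_lt (Submodule.smul_mono_left ?_)
      (Ideal.smul_top_quotient_lt_top hm hI)).ne'
    exact Ideal.span_le.mpr hmem

lemma isRegular_of_isWeaklyRegular_of_mem {I m : Ideal R} (hm : m ≠ ⊤) (hI : I ≤ m)
    {θ : List R} (hθ : IsWeaklyRegular (R ⧸ I) θ) (hθm : ∀ f ∈ θ, f ∈ m) :
    IsRegular (R ⧸ I) θ :=
  ⟨hθ, (lt_of_le_of_lt (Submodule.smul_mono_left (Ideal.span_le.mpr hθm))
      (Ideal.smul_top_quotient_lt_top hm hI)).ne'⟩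

end Socle

section DepthQ

open MvPolynomial

variable {V : Type*} {K : Type*} [Field K]

lemma MvPolynomial.span_range_X_ne_top :
    Ideal.span (Set.range (X : V → MvPolynomial V K)) ≠ ⊤ := by
  intro h
  have hle : Ideal.span (Set.range (X : V → MvPolynomial V K)) ≤
      RingHom.ker (constantCoeff (σ := V) (R := K)) := by
    rw [Ideal.span_le]
    rintro _ ⟨v, rfl⟩
    simp
  have h1 : (1 : MvPolynomial V K) ∈ RingHom.ker (constantCoeff (σ := V) (R := K)) :=
    hle (h ▸ Submodule.mem_top)
  simp at h1

lemma mul_mem_of_mem_span_range_X {A : Ideal (MvPolynomial V K)} {p : MvPolynomial V K}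
    (h : ∀ v, X v * p ∈ A) {f : MvPolynomial V K}
    (hf : f ∈ Ideal.span (Set.range (X : V → MvPolynomial V K))) : f * p ∈ A := by
  induction hf using Submodule.span_induction with
  | mem x hx => obtain ⟨v, rfl⟩ := hx; exact h v
  | zero => simp
  | add x y _ _ hx hy => rw [add_mul]; exact A.add_mem hx hy
  | smul a x _ hx => rw [smul_eq_mul, mul_assoc]; exact A.mul_mem_left a hx

variable [Finite V] {I : Ideal (MvPolynomial V K)}
  (hI : I ≤ Ideal.span (Set.range (X : V → MvPolynomial V K))) {θ : List (MvPolynomial V K)}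
  (hθ : IsWeaklyRegular (MvPolynomial V K ⧸ I) θ)
  (hθm : ∀ f ∈ θ, f ∈ Ideal.span (Set.range (X : V → MvPolynomial V K)))

include hI hθ hθm

lemma depthQ_eq_of_socle {p : MvPolynomial V K} (hp : p ∉ I ⊔ Ideal.ofList θ)
    (hX : ∀ v, X v * p ∈ I ⊔ Ideal.ofList θ) : DS.depthQ K I = θ.length := by
  refine IsGreatest.csSup_eq ⟨⟨θ, rfl, hθm,
    isRegular_of_isWeaklyRegular_of_mem span_range_X_ne_top hI hθ hθm⟩, ?_⟩
  rintro _ ⟨rs, rfl, hrs, reg⟩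
  exact length_le_of_socle span_range_X_ne_top hI hθ hp
    (fun x hx => mul_mem_of_mem_span_range_X hX hx) hrs reg

lemma depthQ_ne_of_no_socle (h0 : θ.length ≠ 0)
    (h : ∀ p, (∀ v, X v * p ∈ I ⊔ Ideal.ofList θ) → p ∈ I ⊔ Ideal.ofList θ) :
    DS.depthQ K I ≠ θ.length := by
  obtain ⟨rs, hlen, hrs, reg⟩ := exists_isRegular_of_no_socle span_range_X_ne_top hI hθ hθm
    fun p hp => h p fun v => hp _ (Ideal.subset_span ⟨v, rfl⟩)
  unfold DS.depthQ
  by_cases hb : BddAbove {n | ∃ rs : List (MvPolynomial V K), rs.length = n ∧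
    (∀ f ∈ rs, f ∈ Ideal.span (Set.range (MvPolynomial.X : V → MvPolynomial V K))) ∧
    RingTheory.Sequence.IsRegular (MvPolynomial V K ⧸ I) rs}
  · have := le_csSup hb ⟨rs, hlen, hrs, reg⟩
    omega
  · rw [csSup_of_not_bddAbove hb, csSup_empty]
    exact h0.symm

end DepthQ

section MonomialIdeals

open MvPolynomial

variable {V : Type*} {K : Type*} [Field K]

lemma Finsupp.mapDomain_apply_eq_sum_filter [Fintype V] [DecidableEq V] (σ : V → V)
    (b : V →₀ ℕ) (x : V) : b.mapDomain σ x = ∑ v with σ v = x, b v := by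
  rw [Finsupp.mapDomain, Finsupp.sum_apply, Finsupp.sum_fintype _ _ (by simp), Finset.sum_filter]
  simp [Finsupp.single_apply]

lemma mem_restrictSupportIdeal {S : Set (V →₀ ℕ)} {hS : IsUpperSet S} {p : MvPolynomial V K} :
    p ∈ restrictSupportIdeal K S hS ↔ ∀ a, coeff a p ≠ 0 → a ∈ S := by
  change (↑p.support ⊆ S) ↔ _
  simp [Set.subset_def]

lemma sub_rename_mem_span (σ : V → V) (p : MvPolynomial V K) :
    p - rename σ p ∈ Ideal.span (Set.range fun v => (X v - X (σ v) : MvPolynomial V K)) := by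
  set A := Ideal.span (Set.range fun v => (X v - X (σ v) : MvPolynomial V K))
  have h : (Ideal.Quotient.mkₐ K A) = (Ideal.Quotient.mkₐ K A).comp (rename σ) := by
    ext v
    simp only [AlgHom.comp_apply, rename_X, Ideal.Quotient.mkₐ_eq_mk]
    exact Ideal.Quotient.eq.mpr (Ideal.subset_span ⟨v, rfl⟩)
  exact Ideal.Quotient.eq.mp (DFunLike.congr_fun h p)

/-- Membership in a monomial ideal enlarged by the identifications `X v = X (σ v)`, expressed
through the monomials of the polynomial obtained after these identifications. -/
lemma mem_sup_span_X_sub_X_iff {σ : V → V} (hσ : ∀ v, σ (σ v) = σ v) {S T : Set (V →₀ ℕ)}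
    (hS : IsUpperSet S) (hT : IsUpperSet T) (h1 : ∀ b ∈ S, b.mapDomain σ ∈ T)
    (h2 : ∀ b : V →₀ ℕ, b.mapDomain σ ∈ T → ∃ b' ∈ S, b'.mapDomain σ = b.mapDomain σ)
    (p : MvPolynomial V K) :
    p ∈ restrictSupportIdeal K S hS ⊔ Ideal.span (Set.range fun v => (X v - X (σ v))) ↔
      rename σ p ∈ restrictSupportIdeal K T hT := by
  constructor
  · suffices restrictSupportIdeal K S hS ⊔ Ideal.span (Set.range fun v => (X v - X (σ v))) ≤
        (restrictSupportIdeal K T hT).comap (rename σ : MvPolynomial V K →ₐ[K] _) from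
      fun h => this h
    refine sup_le (fun f hf => ?_) (Ideal.span_le.mpr ?_)
    · rw [mem_restrictSupportIdeal] at hf
      rw [Ideal.mem_comap, mem_restrictSupportIdeal]
      intro a ha
      obtain ⟨b, rfl, hb⟩ := coeff_rename_ne_zero σ f a ha
      exact h1 b (hf b hb)
    · rintro _ ⟨v, rfl⟩
      simp [hσ]
  · intro hp
    rw [mem_restrictSupportIdeal] at hp
    have hq : ∃ q ∈ restrictSupportIdeal K S hS, rename σ q = rename σ p := by
      have hlift : ∀ a, ∃ b, coeff a (rename σ p) ≠ 0 → b ∈ S ∧ b.mapDomain σ = a := by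
        intro a
        by_cases ha : coeff a (rename σ p) = 0
        · exact ⟨0, fun h => absurd ha h⟩
        · obtain ⟨b, rfl, hb⟩ := coeff_rename_ne_zero σ p a ha
          obtain ⟨b', hb', he⟩ := h2 b (hp _ ha)
          exact ⟨b', fun _ => ⟨hb', he⟩⟩
      choose β hβ using hlift
      refine ⟨∑ a ∈ (rename σ p).support, monomial (β a) (coeff a (rename σ p)),
        Ideal.sum_mem _ fun a ha => ?_, ?_⟩
      · rw [mem_support_iff] at ha
        exact (monomial_mem_restrictSupport (R := K)).mpr (Or.inl (hβ a ha).1)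
      · conv_rhs => rw [(rename σ p).as_sum]
        rw [map_sum]
        refine Finset.sum_congr rfl fun a ha => ?_
        rw [mem_support_iff] at ha
        rw [rename_monomial, (hβ a ha).2]
    obtain ⟨q, hqS, hq⟩ := hq
    have : p = q + ((p - rename σ p) - (q - rename σ q)) := by rw [hq]; ring
    rw [this]
    exact add_mem (Ideal.mem_sup_left hqS) (Ideal.mem_sup_right
      (sub_mem (sub_rename_mem_span σ p) (sub_rename_mem_span σ q)))

/-- Exponents whose entries at the vertices of `C` are bounded below by prescribed functions. -/
def lowerBoundedExps (C : Set V) (g : V → (V →₀ ℕ) → ℕ) : Set (V →₀ ℕ) :=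
  {a | ∀ v ∈ C, g v a ≤ a v}

lemma isUpperSet_lowerBoundedExps {C : Set V} {g : V → (V →₀ ℕ) → ℕ}
    (hg : ∀ v, Antitone (g v)) : IsUpperSet (lowerBoundedExps C g) :=
  fun _ _ hab ha v hv => (hg v hab).trans ((ha v hv).trans (hab v))

lemma coeff_eq_zero_of_X_sub_X_mul {C : Set V} {g : V → (V →₀ ℕ) → ℕ}
    (hg : ∀ v ∈ C, ∀ e ∈ C, ∀ a, g v (a + Finsupp.single e 1) = g v a)
    {e e' : V} (hne : e ≠ e') (he : e ∈ C) (he' : e' ∈ C) {q : MvPolynomial V K}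
    (hq : ∀ a, coeff a ((X e - X e') * q) ≠ 0 → a ∈ lowerBoundedExps C g)
    {v : V} (hv : v ∈ C) (hve : v ≠ e) (a : V →₀ ℕ) (ha : a v < g v a) : coeff a q = 0 := by
  classical
  induction hm : a e' generalizing a with
  | zero =>
    by_contra hne0
    have hmem := hq (a + Finsupp.single e 1) (by
      rw [sub_mul, coeff_sub, add_comm a, coeff_X_mul, coeff_X_mul', if_neg, sub_zero]
      · exact hne0
      · simp [hm, hne])
    have := hmem v hv
    rw [hg v hv e he] at this
    simp [hve.symm] at this
    omega
  | succ m ih =>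
    obtain ⟨a', ha'⟩ : ∃ a', a' + Finsupp.single e' 1 = a + Finsupp.single e 1 := by
      refine ⟨a + Finsupp.single e 1 - Finsupp.single e' 1, tsub_add_cancel_of_le ?_⟩
      rw [Finsupp.single_le_iff, Finsupp.add_apply, hm]
      omega
    have hg' : g v a' = g v a := by rw [← hg v hv e' he', ha', hg v hv e he]
    have hv' : a' v ≤ a v := by
      have := DFunLike.congr_fun ha' v
      simp [hve.symm] at this
      omega
    have he0 : a' e' = m := by
      have := DFunLike.congr_fun ha' e'
      simp [hne] at this
      omega
    have h0 := ih a' (by omega) he0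
    by_contra hne0
    have hmem := hq (a + Finsupp.single e 1) (by
      rw [sub_mul, coeff_sub, add_comm a, coeff_X_mul, add_comm, ← ha', add_comm, coeff_X_mul, h0,
        sub_zero]
      exact hne0)
    have := hmem v hv
    rw [hg v hv e he] at this
    simp [hve.symm] at this
    omega

lemma mem_of_X_sub_X_mul_mem {C : Set V} {g : V → (V →₀ ℕ) → ℕ} (hmono : ∀ v, Antitone (g v))
    (hg : ∀ v ∈ C, ∀ e ∈ C, ∀ a, g v (a + Finsupp.single e 1) = g v a)
    {e e' : V} (hne : e ≠ e') (he : e ∈ C) (he' : e' ∈ C) {q : MvPolynomial V K}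
    (hq : (X e - X e') * q ∈ restrictSupportIdeal K _ (isUpperSet_lowerBoundedExps (C := C) hmono)) :
    q ∈ restrictSupportIdeal K _ (isUpperSet_lowerBoundedExps (C := C) hmono) := by
  have hq' : (X e' - X e) * q ∈
      restrictSupportIdeal K _ (isUpperSet_lowerBoundedExps (C := C) hmono) := by
    rw [← neg_sub, neg_mul]
    exact neg_mem hq
  rw [mem_restrictSupportIdeal] at hq hq' ⊢
  intro a ha v hv
  by_contra! hlt
  by_cases hve : v = e
  · exact ha (coeff_eq_zero_of_X_sub_X_mul hg hne.symm he' he hq' hv (hve ▸ hne) a hlt)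
  · exact ha (coeff_eq_zero_of_X_sub_X_mul hg hne he he' hq hv hve a hlt)

end MonomialIdeals

section CoverIdealPowers

open MvPolynomial

variable {V : Type*} {K : Type*} [Field K] {G : SimpleGraph V}

/-- Exponents whose entries at the ends of every edge of `G` add up to at least `n`. -/
def coverExps (G : SimpleGraph V) (n : ℕ) : Set (V →₀ ℕ) :=
  {a | ∀ u v, G.Adj u v → n ≤ a u + a v}

lemma isUpperSet_coverExps (G : SimpleGraph V) (n : ℕ) : IsUpperSet (coverExps G n) :=
  fun _ _ hab ha u v h => (ha u v h).trans (add_le_add (hab u) (hab v))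

lemma coverIdeal_eq :
    DS.coverIdeal K G = restrictSupportIdeal K _ (isUpperSet_coverExps G 1) := by
  ext p
  rw [mem_restrictSupportIdeal]
  simp only [DS.coverIdeal, DS.symbPow, Submodule.mem_iInf, pow_one, Prod.forall, coverExps,
    Set.mem_ofPred_eq]
  have key : ∀ u v, p ∈ Ideal.span {X u, X v} ↔ ∀ a, coeff a p ≠ 0 → 1 ≤ a u + a v := by
    intro u v
    rw [← Set.image_pair, mem_ideal_span_X_image]
    simp only [mem_support_iff, Set.mem_insert_iff, Set.mem_singleton_iff, exists_eq_or_imp,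
      exists_eq_left]
    refine forall₂_congr fun a _ => ?_
    omega
  simp only [key]
  exact ⟨fun h a ha u v huv => h u v huv a ha, fun h u v huv a ha => h a ha u v huv⟩

lemma coverIdeal_pow_le (n : ℕ) :
    DS.coverIdeal K G ^ n ≤ restrictSupportIdeal K _ (isUpperSet_coverExps G n) := by
  classical
  induction n with
  | zero => exact fun p _ => mem_restrictSupportIdeal.mpr fun a _ u v _ => Nat.zero_le _
  | succ n ih =>
    rw [pow_succ, Ideal.mul_le]
    intro p hp q hq
    have hp' := mem_restrictSupportIdeal.mp (ih hp)
    rw [coverIdeal_eq] at hq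
    have hq' := mem_restrictSupportIdeal.mp hq
    rw [mem_restrictSupportIdeal]
    intro a ha u v huv
    rw [← mem_support_iff] at ha
    obtain ⟨b, hb, c, hc, rfl⟩ := Finset.mem_add.mp (support_mul p q ha)
    have h1 := hp' b (mem_support_iff.mp hb) u v huv
    have h2 := hq' c (mem_support_iff.mp hc) u v huv
    simp only [Finsupp.add_apply]
    omega

lemma coverIdeal_pow_le_span_range_X {u v : V} (huv : G.Adj u v) {n : ℕ} (hn : n ≠ 0) :
    DS.coverIdeal K G ^ n ≤ Ideal.span (Set.range (X : V → MvPolynomial V K)) := by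
  refine (Ideal.pow_le_self hn).trans ((iInf₂_le (u, v) huv).trans ?_)
  rw [pow_one]
  refine Ideal.span_mono ?_
  rintro _ (rfl | rfl) <;> exact ⟨_, rfl⟩

lemma coverIdeal_pow_eq [Finite V] {C : Set V} (hC : ∀ u v, G.Adj u v → (u ∈ C ↔ v ∉ C))
    (n : ℕ) :
    DS.coverIdeal K G ^ n = restrictSupportIdeal K _ (isUpperSet_coverExps G n) := by
  classical
  refine le_antisymm (coverIdeal_pow_le n) fun p hp => ?_
  rw [mem_restrictSupportIdeal] at hp
  rw [p.as_sum]
  refine Ideal.sum_mem _ fun a ha => ?_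
  have ha' : a ∈ coverExps G n := hp a (mem_support_iff.mp ha)
  let c : ℕ → V →₀ ℕ := fun t => Finsupp.equivFunOnFinite.symm fun v =>
    if v ∈ C then (if t < a v then 1 else 0) else (if n ≤ a v + t then 1 else 0)
  have hc : ∀ t v, c t v =
      if v ∈ C then (if t < a v then 1 else 0) else (if n ≤ a v + t then 1 else 0) :=
    fun t v => rfl
  have hle : ∑ t ∈ Finset.range n, c t ≤ a := by
    intro v
    rw [Finsupp.finsetSum_apply]
    simp only [hc]
    by_cases hv : v ∈ C
    · simp only [hv, if_true, Finset.sum_boole, Nat.cast_id]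
      refine (Finset.card_le_card (t := Finset.range (a v)) fun t ht => ?_).trans_eq
        (Finset.card_range _)
      simp only [Finset.mem_filter, Finset.mem_range] at ht ⊢
      exact ht.2
    · simp only [hv, if_false, Finset.sum_boole, Nat.cast_id]
      refine (Finset.card_le_card (t := Finset.Ico (n - a v) n) fun t ht => ?_).trans ?_
      · simp only [Finset.mem_filter, Finset.mem_range, Finset.mem_Ico] at ht ⊢
        omega
      · rw [Nat.card_Ico]
        omega
  have hprod : monomial a (coeff a p) = monomial (a - ∑ t ∈ Finset.range n, c t) (coeff a p) *
      ∏ t ∈ Finset.range n, monomial (c t) (1 : K) := by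
    rw [← monomial_sum_one, monomial_mul, mul_one, tsub_add_cancel_of_le hle]
  rw [hprod]
  refine Ideal.mul_mem_left _ _ ?_
  have hpow : ∏ t ∈ Finset.range n, monomial (c t) (1 : K) ∈
      ∏ _t ∈ Finset.range n, DS.coverIdeal K G := by
    refine Ideal.prod_mem_prod fun t ht => ?_
    rw [coverIdeal_eq]
    refine (monomial_mem_restrictSupport (R := K)).mpr (Or.inl fun u v huv => ?_)
    have h1 := hC u v huv
    have h2 := ha' u v huv
    rw [Finset.mem_range] at ht
    rw [hc, hc]
    split_ifs <;> first | omega | tauto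
  simpa using hpow

end CoverIdealPowers

section Collapse

open MvPolynomial

variable {r : ℕ} {K : Type*} [Field K] {G : SimpleGraph (Fin r)}

open Classical in
/-- The least value at `v` that makes every edge at `v` have weight at least `n`, given the
values of `a` at the neighbours of `v`. -/
noncomputable def minEntry (G : SimpleGraph (Fin r)) (n : ℕ) (v : Fin r) (a : Fin r →₀ ℕ) : ℕ :=
  Finset.univ.sup fun w => if G.Adj v w then n - a w else 0

lemma minEntry_le_iff {n m : ℕ} {v : Fin r} {a : Fin r →₀ ℕ} :
    minEntry G n v a ≤ m ↔ ∀ w, G.Adj v w → n - a w ≤ m := by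
  simp only [minEntry, Finset.sup_le_iff, Finset.mem_univ, forall_const]
  refine forall_congr' fun w => ?_
  split_ifs with h <;> simp [h]

lemma le_minEntry {n : ℕ} {v w : Fin r} (h : G.Adj v w) (a : Fin r →₀ ℕ) :
    n - a w ≤ minEntry G n v a :=
  minEntry_le_iff.mp le_rfl w h

lemma antitone_minEntry (n : ℕ) (v : Fin r) : Antitone (minEntry G n v) := fun _ _ hab =>
  minEntry_le_iff.mpr fun w hw => (Nat.sub_le_sub_left (hab w) n).trans (le_minEntry hw _)

/-- The even vertices. -/
def evenVertices (r : ℕ) : Set (Fin r) := {v | Even v.val}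

/-- The map sending all even vertices up to `c` to `c`. -/
def collapse (c v : Fin r) : Fin r := if Even v.val ∧ v ≤ c then c else v

lemma collapse_eq_iff {c v : Fin r} (hc : Even c.val) :
    collapse c v = c ↔ Even v.val ∧ v ≤ c := by
  unfold collapse
  split_ifs with h
  · simp [h]
  · refine ⟨fun he => absurd ⟨he ▸ hc, he.le⟩ h, fun he => absurd he h⟩

lemma collapse_eq_iff_of_ne {c v x : Fin r} (hx : x ≠ c) (hx' : ¬ (Even x.val ∧ x ≤ c)) :
    collapse c v = x ↔ v = x := by
  unfold collapse
  split_ifs with h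
  · exact ⟨fun he => absurd he.symm hx, fun he => absurd (he ▸ h) hx'⟩
  · rfl

lemma collapse_collapse {c : Fin r} (hc : Even c.val) (v : Fin r) :
    collapse c (collapse c v) = collapse c v := by
  by_cases h : Even v.val ∧ v ≤ c
  · rw [(collapse_eq_iff hc).mpr h, collapse_eq_iff hc]
    exact ⟨hc, le_rfl⟩
  · have : collapse c v = v := if_neg h
    rw [this, this]

lemma mapDomain_collapse_self {c : Fin r} (hc : Even c.val) (b : Fin r →₀ ℕ) :
    b.mapDomain (collapse c) c = ∑ v with Even v.val ∧ v ≤ c, b v := by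
  rw [Finsupp.mapDomain_apply_eq_sum_filter]
  simp only [collapse_eq_iff hc]

lemma mapDomain_collapse_of_not {c x : Fin r} (hc : Even c.val)
    (hx : ¬ (Even x.val ∧ x ≤ c)) (b : Fin r →₀ ℕ) : b.mapDomain (collapse c) x = b x := by
  rw [Finsupp.mapDomain_apply_eq_sum_filter]
  have hne : x ≠ c := fun h => hx ⟨h ▸ hc, h.le⟩
  refine (Finset.sum_congr (Finset.ext fun v => ?_) fun _ _ => rfl).trans (Finset.sum_singleton b x)
  rw [Finset.mem_filter, Finset.mem_singleton, collapse_eq_iff_of_ne hne hx]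
  simp

lemma mapDomain_collapse_of_lt {c x : Fin r} (hc : Even c.val)
    (hx : Even x.val) (hlt : x < c) (b : Fin r →₀ ℕ) : b.mapDomain (collapse c) x = 0 := by
  rw [Finsupp.mapDomain_apply_eq_sum_filter]
  refine Finset.sum_eq_zero fun v hv => ?_
  simp only [Finset.mem_filter, Finset.mem_univ, true_and] at hv
  have := collapse_collapse hc v
  rw [hv, (collapse_eq_iff hc).mpr ⟨hx, hlt.le⟩] at this
  exact absurd this hlt.ne'

/-- Lower bounds for the entries at the even vertices, after the collapse onto `c`. -/
noncomputable def collapsedMinEntry (G : SimpleGraph (Fin r)) (n : ℕ) (c v : Fin r)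
    (a : Fin r →₀ ℕ) : ℕ :=
  if v < c then 0 else if v = c then ∑ u : Fin r with Even u.val ∧ u ≤ c, minEntry G n u a
  else minEntry G n v a

lemma antitone_collapsedMinEntry (n : ℕ) (c v : Fin r) :
    Antitone (collapsedMinEntry G n c v) := by
  intro a b hab
  unfold collapsedMinEntry
  split_ifs
  · exact le_rfl
  · exact Finset.sum_le_sum fun u _ => antitone_minEntry n u hab
  · exact antitone_minEntry n v hab

/-- The ideal obtained from the `n`-th power of the cover ideal by the collapse onto `c`. -/
noncomputable def collapsedIdeal (K : Type*) [Field K] (G : SimpleGraph (Fin r)) (n : ℕ)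
    (c : Fin r) : Ideal (MvPolynomial (Fin r) K) :=
  restrictSupportIdeal K _ (isUpperSet_lowerBoundedExps (C := evenVertices r)
    (antitone_collapsedMinEntry (G := G) n c))

variable (hG : ∀ u v, G.Adj u v → (Even u.val ↔ ¬ Even v.val))

include hG

lemma minEntry_congr {n : ℕ} {v : Fin r} (hv : Even v.val) {a b : Fin r →₀ ℕ}
    (hab : ∀ w : Fin r, ¬ Even w.val → a w = b w) : minEntry G n v a = minEntry G n v b := by
  unfold minEntry
  refine Finset.sup_congr rfl fun w _ => ?_
  split_ifs with h
  · rw [hab w ((hG v w h).mp hv)]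
  · rfl

lemma mem_coverExps_iff {n : ℕ} {a : Fin r →₀ ℕ} :
    a ∈ coverExps G n ↔ ∀ v : Fin r, Even v.val → minEntry G n v a ≤ a v := by
  simp only [minEntry_le_iff]
  constructor
  · intro h v _ w hvw
    have := h v w hvw
    omega
  · intro h u v huv
    by_cases hu : Even u.val
    · have := h u hu v huv
      omega
    · have := h v (by have := hG u v huv; tauto) u huv.symm
      omega

lemma collapsedMinEntry_congr {n : ℕ} {c v : Fin r} (hv : Even v.val) {a b : Fin r →₀ ℕ}
    (hab : ∀ w : Fin r, ¬ Even w.val → a w = b w) :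
    collapsedMinEntry G n c v a = collapsedMinEntry G n c v b := by
  unfold collapsedMinEntry
  split_ifs
  · rfl
  · refine Finset.sum_congr rfl fun u hu => minEntry_congr hG ?_ hab
    simp only [Finset.mem_filter] at hu
    exact hu.2.1
  · exact minEntry_congr hG hv hab

lemma mapDomain_collapse_mem {n : ℕ} {c : Fin r} (hc : Even c.val) {b : Fin r →₀ ℕ}
    (hb : b ∈ coverExps G n) :
    b.mapDomain (collapse c) ∈
      lowerBoundedExps (evenVertices r) (collapsedMinEntry G n c) := by
  intro v hv
  rw [mem_coverExps_iff hG] at hb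
  rw [collapsedMinEntry_congr hG (b := b) hv fun w hw =>
    mapDomain_collapse_of_not hc (fun h => hw h.1) b]
  unfold collapsedMinEntry
  split_ifs with h1 h2
  · exact Nat.zero_le _
  · subst h2
    rw [mapDomain_collapse_self hc]
    refine Finset.sum_le_sum fun u hu => hb u ?_
    simp only [Finset.mem_filter] at hu
    exact hu.2.1
  · rw [mapDomain_collapse_of_not hc fun h => h2 (le_antisymm h.2 (not_lt.mp h1))]
    exact hb v hv

lemma exists_mapDomain_collapse_eq {n : ℕ} {c : Fin r} (hc : Even c.val) {a : Fin r →₀ ℕ}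
    (ha : a.mapDomain (collapse c) ∈
      lowerBoundedExps (evenVertices r) (collapsedMinEntry G n c)) :
    ∃ b ∈ coverExps G n, b.mapDomain (collapse c) = a.mapDomain (collapse c) := by
  have hac := ha c hc
  simp only [collapsedMinEntry, lt_irrefl, if_false, if_true] at hac
  set d := a.mapDomain (collapse c) with hd
  have hsplit : (Finset.univ.filter fun u : Fin r => Even u.val ∧ u ≤ c) =
      insert c (Finset.univ.filter fun u : Fin r => Even u.val ∧ u < c) := by
    ext u
    simp only [Finset.mem_filter, Finset.mem_univ, true_and, Finset.mem_insert, le_iff_eq_or_lt]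
    constructor
    · tauto
    · rintro (rfl | h)
      · exact ⟨hc, Or.inl rfl⟩
      · exact ⟨h.1, Or.inr h.2⟩
  have hnot : c ∉ Finset.univ.filter fun u : Fin r => Even u.val ∧ u < c := by simp
  rw [hsplit, Finset.sum_insert hnot] at hac
  let b : Fin r →₀ ℕ := Finsupp.equivFunOnFinite.symm fun v =>
    if Even v.val ∧ v < c then minEntry G n v d
    else if v = c then d c - ∑ u : Fin r with Even u.val ∧ u < c, minEntry G n u d else d v
  have hb : ∀ v, b v = if Even v.val ∧ v < c then minEntry G n v d
    else if v = c then d c - ∑ u : Fin r with Even u.val ∧ u < c, minEntry G n u d else d v :=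
    fun v => rfl
  have hodd : ∀ w : Fin r, ¬ Even w.val → b w = d w := by
    intro w hw
    rw [hb, if_neg fun h => hw h.1, if_neg fun h : w = c => hw (h ▸ hc)]
  refine ⟨b, (mem_coverExps_iff hG).mpr fun v hv => ?_, ?_⟩
  · rw [minEntry_congr hG hv hodd, hb]
    split_ifs with h1 h2
    · exact le_rfl
    · subst h2
      omega
    · have := ha v hv
      rwa [collapsedMinEntry, if_neg fun h => h1 ⟨hv, h⟩, if_neg h2] at this
  · ext v
    by_cases hv : Even v.val ∧ v ≤ c
    · rcases hv.2.lt_or_eq with hlt | rfl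
      · rw [mapDomain_collapse_of_lt hc hv.1 hlt, hd, mapDomain_collapse_of_lt hc hv.1 hlt]
      · rw [mapDomain_collapse_self hc, hsplit, Finset.sum_insert hnot, hb]
        have hsum : ∑ u : Fin r with Even u.val ∧ u < v, b u =
            ∑ u : Fin r with Even u.val ∧ u < v, minEntry G n u d := by
          refine Finset.sum_congr rfl fun u hu => ?_
          simp only [Finset.mem_filter, Finset.mem_univ, true_and] at hu
          rw [hb, if_pos hu]
        rw [hsum]
        simp only [lt_irrefl, and_false, if_false, if_true]
        omega
    · rw [mapDomain_collapse_of_not hc hv, hb, if_neg fun h => hv ⟨h.1, h.2.le⟩,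
        if_neg fun h : v = c => hv ⟨h ▸ hc, h.le⟩]

lemma mem_coverIdeal_pow_sup_iff {c : Fin r} (hc : Even c.val) (n : ℕ)
    (p : MvPolynomial (Fin r) K) :
    p ∈ DS.coverIdeal K G ^ n ⊔ Ideal.span (Set.range fun v => (X v - X (collapse c v))) ↔
      rename (collapse c) p ∈ collapsedIdeal K G n c := by
  rw [coverIdeal_pow_eq (C := evenVertices r) hG]
  exact mem_sup_span_X_sub_X_iff (collapse_collapse hc) _ _
    (fun b hb => mapDomain_collapse_mem hG hc hb)
    (fun b hb => exists_mapDomain_collapse_eq hG hc hb) p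

lemma mem_collapsedIdeal_of_X_sub_X_mul_mem {n : ℕ} {c e e' : Fin r} (hne : e ≠ e')
    (he : Even e.val) (he' : Even e'.val) {q : MvPolynomial (Fin r) K}
    (hq : (X e - X e') * q ∈ collapsedIdeal K G n c) : q ∈ collapsedIdeal K G n c := by
  refine mem_of_X_sub_X_mul_mem (antitone_collapsedMinEntry n c) (fun v hv e he a => ?_) hne he he' hq
  refine collapsedMinEntry_congr hG hv fun w hw => ?_
  have : w ≠ e := fun h => hw (h ▸ he)
  simp [this.symm]

end Collapse

section RegularSequence

open MvPolynomial

variable {r : ℕ} {K : Type*} [Field K] {G : SimpleGraph (Fin r)}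

/-- The variable with index `i`, or zero if there is none. -/
noncomputable def variableOrZero (K : Type*) [Field K] (r i : ℕ) : MvPolynomial (Fin r) K :=
  if h : i < r then X ⟨i, h⟩ else 0

lemma variableOrZero_val (v : Fin r) : variableOrZero K r v.val = X v := dif_pos v.isLt

/-- The differences of the consecutive members of `x_0, x_2, …, x_{2k}`. -/
noncomputable def evenDifferences (K : Type*) [Field K] (r k : ℕ) :
    List (MvPolynomial (Fin r) K) :=
  (List.range k).map fun i => variableOrZero K r (2 * i) - variableOrZero K r (2 * i + 2)

lemma length_evenDifferences (k : ℕ) : (evenDifferences K r k).length = k := by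
  simp [evenDifferences]

lemma take_evenDifferences {k l : ℕ} (h : k ≤ l) :
    (evenDifferences K r l).take k = evenDifferences K r k := by
  simp [evenDifferences, ← List.map_take, List.take_range, h]

lemma mem_span_of_mem_evenDifferences {k : ℕ} {f : MvPolynomial (Fin r) K}
    (hf : f ∈ evenDifferences K r k) :
    f ∈ Ideal.span (Set.range (X : Fin r → MvPolynomial (Fin r) K)) := by
  have h : ∀ i, variableOrZero K r i ∈
      Ideal.span (Set.range (X : Fin r → MvPolynomial (Fin r) K)) := by
    intro i
    unfold variableOrZero
    split_ifs with hi
    · exact Ideal.subset_span ⟨_, rfl⟩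
    · exact zero_mem _
  obtain ⟨i, -, rfl⟩ := List.mem_map.mp hf
  exact sub_mem (h _) (h _)

lemma ofList_evenDifferences {c : Fin r} {k : ℕ} (hc : c.val = 2 * k) :
    Ideal.ofList (evenDifferences K r k) =
      Ideal.span (Set.range fun v => (X v - X (collapse c v) : MvPolynomial (Fin r) K)) := by
  have hce : Even c.val := ⟨k, by omega⟩
  apply le_antisymm
  · refine Ideal.span_le.mpr fun f hf => ?_
    obtain ⟨i, hi, rfl⟩ := List.mem_map.mp hf
    rw [List.mem_range] at hi
    have key : ∀ j, j ≤ k → variableOrZero K r (2 * j) - X c ∈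
        Ideal.span (Set.range fun v => (X v - X (collapse c v) : MvPolynomial (Fin r) K)) := by
      intro j hj
      have hjr : 2 * j < r := by omega
      have hcol : collapse c ⟨2 * j, hjr⟩ = c :=
        (collapse_eq_iff hce).mpr ⟨even_two_mul j, by rw [Fin.le_def]; simp only; omega⟩
      refine Ideal.subset_span ⟨⟨2 * j, hjr⟩, ?_⟩
      simp only [hcol, variableOrZero, hjr, dif_pos]
    have := sub_mem (key i hi.le) (key (i + 1) hi)
    rwa [sub_sub_sub_cancel_right] at this
  · rw [Ideal.span_le]
    rintro _ ⟨v, rfl⟩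
    by_cases hv : Even v.val ∧ v ≤ c
    · simp only [(collapse_eq_iff hce).mpr hv]
      have key : ∀ j, j ≤ k → variableOrZero K r 0 - variableOrZero K r (2 * j) ∈
          Ideal.ofList (evenDifferences K r k) := by
        intro j
        induction j with
        | zero => simp
        | succ j ih =>
          intro hj
          have hmem : variableOrZero K r (2 * j) - variableOrZero K r (2 * j + 2) ∈
              Ideal.ofList (evenDifferences K r k) :=
            Ideal.subset_span (List.mem_map.mpr ⟨j, List.mem_range.mpr hj, rfl⟩)
          have := add_mem (ih (by omega)) hmem
          rwa [sub_add_sub_cancel] at this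
      obtain ⟨⟨j, hj⟩, hle⟩ := hv
      rw [Fin.le_def] at hle
      have := sub_mem (key k le_rfl) (key j (by omega))
      rw [sub_sub_sub_cancel_left, ← hc, two_mul, ← hj, variableOrZero_val,
        variableOrZero_val] at this
      exact this
    · have : collapse c v = v := if_neg hv
      simp [this]

variable (hG : ∀ u v, G.Adj u v → (Even u.val ↔ ¬ Even v.val)) {c : Fin r} {L : ℕ}
  (hc : c.val = 2 * L)

include hG hc

lemma isWeaklyRegular_evenDifferences (n : ℕ) :
    IsWeaklyRegular (MvPolynomial (Fin r) K ⧸ DS.coverIdeal K G ^ n)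
      (evenDifferences K r L) := by
  refine ⟨fun i hi => ?_⟩
  have hiL : i < L := by rwa [length_evenDifferences] at hi
  rw [take_evenDifferences hiL.le, isSMulRegular_quotient_smul_top_iff]
  let d : Fin r := ⟨2 * i, by omega⟩
  let e : Fin r := ⟨2 * i + 2, by omega⟩
  have hd : Even d.val := even_two_mul i
  have he : Even e.val := ⟨i + 1, by simp only [e]; omega⟩
  have hde : d < e := by rw [Fin.lt_def]; simp only [d, e]; omega
  have hget : (evenDifferences K r L)[i] = X d - X e := by
    simp only [evenDifferences, List.getElem_map, List.getElem_range]
    rw [← variableOrZero_val d, ← variableOrZero_val e]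
  rw [hget, ofList_evenDifferences (c := d) rfl]
  intro p hp
  rw [mem_coverIdeal_pow_sup_iff hG hd] at hp ⊢
  have hcd : collapse d d = d := (collapse_eq_iff hd).mpr ⟨hd, le_rfl⟩
  have hcol : collapse d e = e := if_neg fun h => absurd h.2 (not_le.mpr hde)
  rw [map_mul, map_sub, rename_X, rename_X, hcd, hcol] at hp
  exact mem_collapsedIdeal_of_X_sub_X_mul_mem hG hde.ne hd he hp

variable (hlast : ∀ v : Fin r, Even v.val → v ≤ c)

include hlast

lemma mem_pow_sup_ofList_evenDifferences_iff {n : ℕ} {p : MvPolynomial (Fin r) K} :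
    p ∈ DS.coverIdeal K G ^ n ⊔ Ideal.ofList (evenDifferences K r L) ↔
      ∀ a, coeff a (rename (collapse c) p) ≠ 0 → collapsedMinEntry G n c c a ≤ a c := by
  have hce : Even c.val := ⟨L, by omega⟩
  rw [ofList_evenDifferences hc, mem_coverIdeal_pow_sup_iff hG hce, collapsedIdeal,
    mem_restrictSupportIdeal]
  refine forall₂_congr fun a _ => ⟨fun h => h c hce, fun h v hv => ?_⟩
  rcases (hlast v hv).lt_or_eq with hlt | rfl
  · simp [collapsedMinEntry, hlt]
  · exact h

lemma depthQ_pow_eq {n : ℕ} (hn : n ≠ 0) {w₀ w₁ : Fin r} (hw : G.Adj w₀ w₁) {a : Fin r →₀ ℕ}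
    (ha : ∀ w : Fin r, ¬ Even w.val →
      collapsedMinEntry G n c c (a + Finsupp.single w 1) < collapsedMinEntry G n c c a) :
    DS.depthQ K (DS.coverIdeal K G ^ n) = L := by
  classical
  have hce : Even c.val := ⟨L, by omega⟩
  have hpos : 0 < collapsedMinEntry G n c c a := by
    by_cases h : Even w₀.val
    · exact (Nat.zero_le _).trans_lt (ha w₁ ((hG _ _ hw).mp h))
    · exact (Nat.zero_le _).trans_lt (ha w₀ h)
  set m := collapsedMinEntry G n c c a with hm
  let b : Fin r →₀ ℕ := a.filter (fun w => ¬ Even w.val) + Finsupp.single c (m - 1)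
  have hbodd : ∀ w : Fin r, ¬ Even w.val → b w = a w := by
    intro w hw'
    have : w ≠ c := fun h => hw' (h ▸ hce)
    simp [b, Nat.not_even_iff_odd.mp hw', this.symm]
  have hbc : b c = m - 1 := by simp [b, hce]
  have hbmap : b.mapDomain (collapse c) = b := by
    rw [Finsupp.mapDomain_congr (g := id), Finsupp.mapDomain_id]
    intro x hx
    by_cases hxe : Even x.val
    · have hxc : x = c := by
        by_contra hne
        exact Finsupp.mem_support_iff.mp hx (by simp [b, hxe, Ne.symm hne])
      rw [hxc]
      exact (collapse_eq_iff hce).mpr ⟨hce, le_rfl⟩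
    · exact if_neg fun h => hxe h.1
  have key := depthQ_eq_of_socle (K := K) (coverIdeal_pow_le_span_range_X hw hn)
    (isWeaklyRegular_evenDifferences hG hc n)
    (fun f hf => mem_span_of_mem_evenDifferences hf) (p := monomial b 1) ?_ fun v => ?_
  · rwa [length_evenDifferences] at key
  · rw [mem_pow_sup_ofList_evenDifferences_iff hG hc hlast]
    intro h
    have := h b (by rw [rename_monomial, hbmap]; simp)
    rw [collapsedMinEntry_congr hG hce hbodd, hbc] at this
    omega
  · rw [mem_pow_sup_ofList_evenDifferences_iff hG hc hlast]
    intro d hd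
    rw [map_mul, rename_monomial, hbmap, rename_X, mul_comm, X,
      monomial_mul, coeff_monomial] at hd
    have hd' : b + Finsupp.single (collapse c v) 1 = d := by
      by_contra hne
      simp [hne] at hd
    subst hd'
    by_cases hv : Even v.val
    · rw [(collapse_eq_iff hce).mpr ⟨hv, hlast v hv⟩]
      rw [collapsedMinEntry_congr hG (b := a) hce fun w hw' => by
        have : w ≠ c := fun h => hw' (h ▸ hce)
        simp [hbodd w hw', this.symm]]
      simp only [Finsupp.add_apply, hbc, Finsupp.single_eq_same]
      omega
    · have hcol : collapse c v = v := if_neg fun h => hv h.1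
      have hvc : v ≠ c := fun h => hv (h ▸ hce)
      rw [hcol, collapsedMinEntry_congr hG (b := a + Finsupp.single v 1) hce fun w hw' => by
        simp [hbodd w hw']]
      have := ha v hv
      simp only [Finsupp.add_apply, hbc]
      omega

lemma depthQ_pow_ne {n : ℕ} (hn : n ≠ 0) {w₀ w₁ : Fin r} (hw : G.Adj w₀ w₁) (hL : L ≠ 0)
    (ha : ∀ a : Fin r →₀ ℕ, ∃ w : Fin r, ¬ Even w.val ∧
      collapsedMinEntry G n c c a ≤ collapsedMinEntry G n c c (a + Finsupp.single w 1)) :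
    DS.depthQ K (DS.coverIdeal K G ^ n) ≠ L := by
  classical
  have hce : Even c.val := ⟨L, by omega⟩
  have key := depthQ_ne_of_no_socle (K := K) (coverIdeal_pow_le_span_range_X hw hn)
    (isWeaklyRegular_evenDifferences hG hc n)
    (fun f hf => mem_span_of_mem_evenDifferences hf) (by rwa [length_evenDifferences])
    fun p hp => ?_
  · rwa [length_evenDifferences] at key
  · rw [mem_pow_sup_ofList_evenDifferences_iff hG hc hlast]
    intro d hd
    obtain ⟨w, hwo, hle⟩ := ha d
    have := (mem_pow_sup_ofList_evenDifferences_iff hG hc hlast).mp (hp w)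
      (d + Finsupp.single w 1) (by
        have hcol : collapse c w = w := if_neg fun h => hwo h.1
        rwa [map_mul, rename_X, hcol, add_comm, coeff_X_mul])
    have hwc : w ≠ c := fun h => hwo (h ▸ hce)
    refine hle.trans (this.trans_eq ?_)
    simp [hwc.symm]

end RegularSequence

section Peaks

variable {r : ℕ} {G : SimpleGraph (Fin r)}

lemma minEntry_add_single_lt_iff {n : ℕ} {v w : Fin r} {a : Fin r →₀ ℕ} :
    minEntry G n v (a + Finsupp.single w 1) < minEntry G n v a ↔
      G.Adj v w ∧ a w < n ∧ ∀ w', w' ≠ w → G.Adj v w' → n - a w' < n - a w := by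
  have hne : ∀ w', w' ≠ w → (a + Finsupp.single w 1 : Fin r →₀ ℕ) w' = a w' := by
    intro w' hw'
    simp [hw'.symm]
  have heq : (a + Finsupp.single w 1 : Fin r →₀ ℕ) w = a w + 1 := by simp
  constructor
  · contrapose!
    intro h
    refine minEntry_le_iff.mpr fun u hu => ?_
    by_cases huw : u = w
    · subst huw
      rcases lt_or_ge (a u) n with hlt | hge
      · obtain ⟨w', hw', hadj, hle⟩ := h hu hlt
        refine hle.trans ?_
        rw [← hne w' hw']
        exact le_minEntry hadj _
      · rw [Nat.sub_eq_zero_of_le hge]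
        exact Nat.zero_le _
    · rw [← hne u huw]
      exact le_minEntry hu _
  · rintro ⟨hadj, hlt, h⟩
    refine lt_of_le_of_lt (b := n - a w - 1) (minEntry_le_iff.mpr fun u hu => ?_)
      (lt_of_lt_of_le (by omega) (le_minEntry hadj a))
    by_cases huw : u = w
    · rw [huw, heq]
      omega
    · rw [hne u huw]
      have := h u huw hu
      omega

lemma collapsedMinEntry_add_single_lt_iff {n : ℕ} {c w : Fin r}
    (hlast : ∀ v : Fin r, Even v.val → v ≤ c) {a : Fin r →₀ ℕ} :
    collapsedMinEntry G n c c (a + Finsupp.single w 1) < collapsedMinEntry G n c c a ↔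
      ∃ v : Fin r, Even v.val ∧
        minEntry G n v (a + Finsupp.single w 1) < minEntry G n v a := by
  simp only [collapsedMinEntry, lt_irrefl, if_false, if_true]
  constructor
  · intro h
    obtain ⟨v, hv, hlt⟩ := Finset.exists_lt_of_sum_lt h
    simp only [Finset.mem_filter] at hv
    exact ⟨v, hv.2.1, hlt⟩
  · rintro ⟨v, hv, hlt⟩
    refine Finset.sum_lt_sum (fun u _ => antitone_minEntry n u le_self_add) ⟨v, ?_, hlt⟩
    simp [hv, hlast v hv]

lemma pathGraph_adj_even (u v : Fin r) (h : (SimpleGraph.pathGraph r).Adj u v) :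
    Even u.val ↔ ¬ Even v.val := by
  rw [SimpleGraph.pathGraph_adj] at h
  rcases h with h | h
  · rw [← h, Nat.even_add_one, not_not]
  · rw [← h, Nat.even_add_one]

/-- Every odd vertex `w` of the path has a neighbour `v` such that the edge from `v` to `w` is the
only one responsible for the least admissible value at `v`. -/
def HasPeaks (n : ℕ) (a : Fin r →₀ ℕ) : Prop :=
  ∀ w : Fin r, ¬ Even w.val → a w < n ∧
    ((∀ w' : Fin r, w'.val + 2 = w.val → n - a w' < n - a w) ∨
      (w.val + 1 < r ∧ ∀ w' : Fin r, w.val + 2 = w'.val → n - a w' < n - a w))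

lemma hasPeaks_iff {n : ℕ} {c : Fin r} (hlast : ∀ v : Fin r, Even v.val → v ≤ c)
    {a : Fin r →₀ ℕ} :
    HasPeaks n a ↔ ∀ w : Fin r, ¬ Even w.val →
      collapsedMinEntry (SimpleGraph.pathGraph r) n c c (a + Finsupp.single w 1) <
        collapsedMinEntry (SimpleGraph.pathGraph r) n c c a := by
  refine forall₂_congr fun w hw => ?_
  rw [collapsedMinEntry_add_single_lt_iff hlast]
  simp only [minEntry_add_single_lt_iff, SimpleGraph.pathGraph_adj]
  rw [Nat.not_even_iff] at hw
  constructor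
  · rintro ⟨hn, h | ⟨hwr, h⟩⟩
    · refine ⟨⟨w.val - 1, by omega⟩, Nat.even_iff.mpr (by simp only; omega),
        Or.inl (by simp only; omega), hn, fun w' hw' hadj => h w' ?_⟩
      rw [Fin.ne_iff_vne] at hw'
      simp only at hadj
      omega
    · refine ⟨⟨w.val + 1, hwr⟩, Nat.even_iff.mpr (by simp only; omega),
        Or.inr rfl, hn, fun w' hw' hadj => h w' ?_⟩
      rw [Fin.ne_iff_vne] at hw'
      simp only at hadj
      omega
  · rintro ⟨v, hv, hadj | hadj, hn, h⟩
    · refine ⟨hn, Or.inl fun w' hw' => h w' ?_ (Or.inr (by omega))⟩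
      rintro rfl
      omega
    · refine ⟨hn, Or.inr ⟨by omega, fun w' hw' => h w' ?_ (Or.inl (by omega))⟩⟩
      rintro rfl
      omega

lemma exists_hasPeaks_of_even (hr : Even r) {n : ℕ} (hn : r / 2 ≤ n) :
    ∃ a : Fin r →₀ ℕ, HasPeaks n a := by
  rw [Nat.even_iff] at hr
  refine ⟨Finsupp.equivFunOnFinite.symm fun w => n - (w.val + 1) / 2, fun w hw => ?_⟩
  rw [Nat.not_even_iff] at hw
  simp only [Finsupp.equivFunOnFinite_symm_apply_apply]
  exact ⟨by omega, Or.inl fun w' hw' => by omega⟩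

lemma exists_hasPeaks_of_odd (hr : Odd r) {n : ℕ} (hn : (r - 1 + 3) / 4 ≤ n) :
    ∃ a : Fin r →₀ ℕ, HasPeaks n a := by
  rw [Nat.odd_iff] at hr
  refine ⟨Finsupp.equivFunOnFinite.symm fun w => n - min ((w.val + 1) / 2) ((r - w.val) / 2),
    fun w hw => ?_⟩
  rw [Nat.not_even_iff] at hw
  simp only [Finsupp.equivFunOnFinite_symm_apply_apply]
  refine ⟨by omega, ?_⟩
  rcases le_or_gt ((w.val + 1) / 2) ((r - w.val) / 2) with h | h
  · exact Or.inl fun w' hw' => by omega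
  · exact Or.inr ⟨by omega, fun w' hw' => by omega⟩

lemma le_or_lt_of_forall_lt_or_lt {f : ℕ → ℕ} {s : ℕ}
    (h : ∀ j < s, f j < f (j + 1) ∨ f (j + 2) < f (j + 1)) (k : ℕ) (hk : k < s) :
    k + 1 ≤ f (k + 1) ∨ f (k + 2) < f (k + 1) := by
  induction k with
  | zero => exact (h 0 hk).imp_left fun h => by omega
  | succ k ih =>
    have := ih (by omega)
    have h1 := h (k + 1) hk
    rw [show k + 1 + 1 = k + 2 from rfl] at h1 ⊢
    omega

lemma le_of_lt_of_forall_lt_or_lt {f : ℕ → ℕ} {s : ℕ}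
    (h : ∀ j < s, f j < f (j + 1) ∨ f (j + 2) < f (j + 1)) (i k : ℕ) (hik : k + i + 1 = s)
    (hk : f (k + 2) < f (k + 1)) : i + 1 ≤ f (k + 1) := by
  induction i generalizing k with
  | zero => omega
  | succ i ih =>
    have h1 := h (k + 1) (by omega)
    have h2 := ih (k + 1) (by omega)
    rw [show k + 1 + 2 = k + 3 from rfl, show k + 1 + 1 = k + 2 from rfl] at h1 h2
    omega

/-- The values `n - a w` at the odd vertices `w`, preceded by zero and followed by `t`. -/
def oddHeights (n t : ℕ) (a : Fin r →₀ ℕ) : ℕ → ℕ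
  | 0 => 0
  | j + 1 => if h : 2 * j + 1 < r then n - a ⟨2 * j + 1, h⟩ else t

lemma oddHeights_lt_or_lt {n t : ℕ} {a : Fin r →₀ ℕ} (ha : HasPeaks n a)
    (ht : Even r ∨ t = 0) (j : ℕ) (hj : j < r / 2) :
    oddHeights n t a j < oddHeights n t a (j + 1) ∨
      oddHeights n t a (j + 2) < oddHeights n t a (j + 1) := by
  have hjr : 2 * j + 1 < r := by omega
  obtain ⟨hn, h⟩ := ha ⟨2 * j + 1, hjr⟩ (by rw [Nat.not_even_iff]; simp only; omega)
  have h1 : oddHeights n t a (j + 1) = n - a ⟨2 * j + 1, hjr⟩ := dif_pos hjr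
  rw [h1]
  refine h.imp (fun h => ?_) fun ⟨hr, h⟩ => ?_
  · cases j with
    | zero => exact Nat.sub_pos_of_lt hn
    | succ i =>
      have hir : 2 * i + 1 < r := by omega
      have h2 : oddHeights n t a (i + 1) = n - a ⟨2 * i + 1, hir⟩ := dif_pos hir
      rw [h2]
      exact h ⟨2 * i + 1, hir⟩ rfl
  · by_cases hir : 2 * (j + 1) + 1 < r
    · have h2 : oddHeights n t a (j + 2) = n - a ⟨2 * (j + 1) + 1, hir⟩ := dif_pos hir
      rw [h2]
      exact h ⟨2 * (j + 1) + 1, hir⟩ rfl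
    · have h2 : oddHeights n t a (j + 2) = t := dif_neg hir
      rw [h2]
      rw [Nat.even_iff] at ht
      simp only at hr
      omega

lemma oddHeights_le {n t : ℕ} (a : Fin r →₀ ℕ) {j : ℕ} (hj : j < r / 2) :
    oddHeights n t a (j + 1) ≤ n :=
  (dif_pos (by omega : 2 * j + 1 < r)).trans_le (Nat.sub_le _ _)

lemma le_of_hasPeaks_of_even (hr : Even r) {n : ℕ} {a : Fin r →₀ ℕ} (ha : HasPeaks n a) :
    r / 2 ≤ n := by
  by_contra! hlt
  have h := le_or_lt_of_forall_lt_or_lt (oddHeights_lt_or_lt (t := n) ha (Or.inl hr))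
    (r / 2 - 1) (by omega)
  have h1 := oddHeights_le (n := n) (t := n) a (j := r / 2 - 1) (by omega)
  have h2 : oddHeights n n a (r / 2 - 1 + 2) = n := dif_neg (by omega)
  omega

lemma le_of_hasPeaks_of_odd (hr : Odd r) {n : ℕ} {a : Fin r →₀ ℕ} (ha : HasPeaks n a) :
    (r - 1 + 3) / 4 ≤ n := by
  rw [Nat.odd_iff] at hr
  by_contra! hlt
  have hp := oddHeights_lt_or_lt (t := 0) ha (Or.inr rfl)
  have h1 := oddHeights_le (n := n) (t := 0) a (j := n) (by omega)
  rcases le_or_lt_of_forall_lt_or_lt hp n (by omega) with h | h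
  · omega
  · have := le_of_lt_of_forall_lt_or_lt hp (r / 2 - n - 1) n (by omega) h
    omega

lemma dst_pathGraph_eq (K : Type*) [Field K] (hr : 2 ≤ r) {n₀ : ℕ} (h1 : 1 ≤ n₀)
    (hr' : 2 ≤ n₀ → 3 ≤ r)
    (hn₀ : ∀ n, n₀ ≤ n → ∃ a : Fin r →₀ ℕ, HasPeaks n a)
    (hlow : ∀ n, ∀ a : Fin r →₀ ℕ, HasPeaks n a → n₀ ≤ n) :
    DS.dst K (SimpleGraph.pathGraph r) = n₀ := by
  let c : Fin r := ⟨2 * ((r - 1) / 2), by omega⟩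
  have hlast : ∀ v : Fin r, Even v.val → v ≤ c := by
    intro v hv
    rw [Nat.even_iff] at hv
    rw [Fin.le_def]
    simp only [c]
    omega
  have hadj : (SimpleGraph.pathGraph r).Adj ⟨0, by omega⟩ ⟨1, by omega⟩ := by
    simp [SimpleGraph.pathGraph_adj]
  have heq : ∀ n, n₀ ≤ n →
      DS.depthQ K (DS.coverIdeal K (SimpleGraph.pathGraph r) ^ n) = (r - 1) / 2 := by
    intro n hn
    obtain ⟨a, ha⟩ := hn₀ n hn
    exact depthQ_pow_eq pathGraph_adj_even (c := c) rfl hlast (by omega) hadj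
      ((hasPeaks_iff hlast).mp ha)
  refine IsLeast.csInf_eq ⟨⟨h1, fun m n hm hn => (heq m hm).trans (heq n hn).symm⟩, ?_⟩
  rintro m ⟨hm1, hm⟩
  by_contra! hlt
  refine depthQ_pow_ne (K := K) pathGraph_adj_even (c := c) rfl hlast (n := n₀ - 1) (by omega)
    hadj (by have := hr' (by omega); omega) (fun a => ?_)
    ((hm (n₀ - 1) n₀ (by omega) hlt.le).trans (heq n₀ le_rfl))
  by_contra! h
  have := hlow (n₀ - 1) a ((hasPeaks_iff hlast).mpr h)
  omega

end Peaks

end Auxiliary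

/-- For the path `P_r` with `r ≥ 2` vertices: `dst(J(P_r)) = r/2` if `r` is even, and
`dst(J(P_r)) = ⌈(r−1)/4⌉` if `r` is odd. -/
theorem stmt_17 (K : Type*) [Field K] (r : ℕ) (hr : 2 ≤ r) :
    (Even r → DS.dst K (SimpleGraph.pathGraph r) = r / 2) ∧
    (Odd r → DS.dst K (SimpleGraph.pathGraph r) = (r - 1 + 3) / 4) := by
  refine ⟨fun h => ?_, fun h => ?_⟩
  · exact dst_pathGraph_eq K hr (by omega) (by omega) (fun n => exists_hasPeaks_of_even h)
      fun n a => le_of_hasPeaks_of_even h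
  · exact dst_pathGraph_eq K hr (by omega) (by omega) (fun n => exists_hasPeaks_of_odd h)
      fun n a => le_of_hasPeaks_of_odd h
end
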